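/- Let Q0 be a cube in ℝ^d and λ > 0. The following are equivalent: (i) (John–Nirenberg inequality with exponent 1/λ) for each f ∈ BMO(Q0) there exist c1, c2 > 0 such that |{x ∈ Q0 : |f(x) − f_{Q0}| > ξ}| ≤ c1 exp(−c2 (ξ/||f||_{BMO(Q0)})^{1/λ}) for all ξ > 0; (ii) for all 1 < p < ∞ and 0 < r ≤ ∞ there is C > 0 such that ∫_0^{t(1−log t)^{−λp}} (u^{1/p} ((f − f_{Q0})^*(u))^r du/u ≤ C ∫_0^{t} (u^{1/p} ((f^#_{Q0})^*(u))^r du/u for all f ∈ L_{p,r}(Q0) and t ∈ (0,1); (iii) λ ≥ 1. -/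

import Mathlib

open MeasureTheory ENNReal Set Filter

noncomputable section

abbrev Euc (d : ℕ) := EuclideanSpace ℝ (Fin d)

/-- Non-increasing rearrangement of an `ℝ≥0∞`-valued function w.r.t. a measure. -/
def rearr {α : Type*} [MeasurableSpace α] (μ : Measure α) (g : α → ℝ≥0∞) (t : ℝ) : ℝ≥0∞ :=
  sInf {l : ℝ≥0∞ | μ {x | l < g x} ≤ ENNReal.ofReal t}

/-- Non-increasing rearrangement of a real-valued function. -/
def rearrR {α : Type*} [MeasurableSpace α] (μ : Measure α) (f : α → ℝ) (t : ℝ) : ℝ≥0∞ :=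
  rearr μ (fun x => ENNReal.ofReal |f x|) t

/-- The maximal function `f^{**}(t) = t⁻¹ ∫_0^t f^*`. -/
def rearrStar {α : Type*} [MeasurableSpace α] (μ : Measure α) (f : α → ℝ) (t : ℝ) : ℝ≥0∞ :=
  (ENNReal.ofReal t)⁻¹ * ∫⁻ s in Set.Ioo (0:ℝ) t, rearrR μ f s

/-- `(∫_I g(t)^q dt/t)^{1/q}`, with the usual sup modification when `q = ∞`. -/
def qnorm (q : ℝ≥0∞) (I : Set ℝ) (g : ℝ → ℝ≥0∞) : ℝ≥0∞ :=
  if q = ∞ then ⨆ t ∈ I, g t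
  else (∫⁻ t in I, g t ^ q.toReal / ENNReal.ofReal t) ^ (1 / q.toReal)

/-- `∫_I g(t)^q dt/t` (no outer power), with the sup modification when `q = ∞`. -/
def qint (q : ℝ≥0∞) (I : Set ℝ) (g : ℝ → ℝ≥0∞) : ℝ≥0∞ :=
  if q = ∞ then ⨆ t ∈ I, g t
  else ∫⁻ t in I, g t ^ q.toReal / ENNReal.ofReal t

/-- Lorentz quasinorm `(∫_I (t^{1/p} f^*(t))^q dt/t)^{1/q}`. -/
def lorentz {α : Type*} [MeasurableSpace α] (μ : Measure α) (f : α → ℝ)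
    (p : ℝ) (q : ℝ≥0∞) (I : Set ℝ) : ℝ≥0∞ :=
  qnorm q I (fun t => ENNReal.ofReal (t ^ (1 / p)) * rearrR μ f t)

/-- The cube with lower-left corner `a` and side length `l`. -/
def cubeSet {d : ℕ} (a : Fin d → ℝ) (l : ℝ) : Set (Euc d) :=
  {x | ∀ i, a i ≤ x i ∧ x i ≤ a i + l}

/-- Cubes in `ℝ^d` with sides parallel to the coordinate axes. -/
def IsCube {d : ℕ} (Q : Set (Euc d)) : Prop := ∃ a l, 0 < l ∧ Q = cubeSet a l

/-- The sharp maximal function `f^{#}` on `ℝ^d`. -/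
def sharp {d : ℕ} (f : Euc d → ℝ) (x : Euc d) : ℝ≥0∞ :=
  ⨆ Q ∈ {Q : Set (Euc d) | IsCube Q ∧ x ∈ Q},
    ENNReal.ofReal (⨍ y in Q, |f y - ⨍ z in Q, f z|)

/-- The local sharp maximal function `f^{#}_{Q_0;μ}`. -/
def sharpLocal {d : ℕ} (μ : Measure (Euc d)) (Q0 : Set (Euc d)) (f : Euc d → ℝ)
    (x : Euc d) : ℝ≥0∞ :=
  ⨆ Q ∈ {Q : Set (Euc d) | IsCube Q ∧ x ∈ Q ∧ Q ⊆ Q0},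
    ENNReal.ofReal (⨍ y in Q, |f y - ⨍ z in Q, f z ∂μ| ∂μ)

def diffOp {d : ℕ} (h : Euc d) (f : Euc d → ℝ) : Euc d → ℝ := fun x => f (x + h) - f x

/-- The iterated difference `Δ_h^k f`. -/
def iterDiff {d : ℕ} (k : ℕ) (h : Euc d) (f : Euc d → ℝ) : Euc d → ℝ := (diffOp h)^[k] f

/-- The modulus of smoothness `ω_k(f,t)_{p,q}` on `ℝ^d`. -/
def modulus {d : ℕ} (k : ℕ) (f : Euc d → ℝ) (p : ℝ) (q : ℝ≥0∞) (t : ℝ) : ℝ≥0∞ :=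
  ⨆ h ∈ {h : Euc d | ‖h‖ ≤ t}, lorentz volume (iterDiff k h f) p q (Set.Ioi 0)


/-- The `BMO(Q_0)` norm. -/
def bmoQ {d : ℕ} (Q0 : Set (Euc d)) (f : Euc d → ℝ) : ℝ≥0∞ :=
  ⨆ x ∈ Q0, sharpLocal volume Q0 f x

lemma s9_cubeSet_eq {d : ℕ} (a : Fin d → ℝ) (l : ℝ) :
    cubeSet a l = (WithLp.ofLp : Euc d → (Fin d → ℝ)) ⁻¹'
      (Set.univ.pi fun i => Set.Icc (a i) (a i + l)) := by
  ext x
  simp only [mem_preimage, mem_univ_pi, mem_Icc]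
  rfl

lemma s9_measurableSet_cubeSet {d : ℕ} (a : Fin d → ℝ) (l : ℝ) :
    MeasurableSet (cubeSet a l) := by
  rw [s9_cubeSet_eq]
  exact (PiLp.volume_preserving_ofLp (Fin d)).measurable
    (MeasurableSet.univ_pi fun i => measurableSet_Icc)

lemma s9_volume_cubeSet {d : ℕ} (a : Fin d → ℝ) {l : ℝ} (hl : 0 ≤ l) :
    volume (cubeSet a l) = ENNReal.ofReal (l ^ d) := by
  rw [s9_cubeSet_eq, (PiLp.volume_preserving_ofLp (Fin d)).measure_preimage
    (MeasurableSet.univ_pi fun i => measurableSet_Icc).nullMeasurableSet]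
  rw [volume_pi_pi]
  simp [ENNReal.ofReal_pow hl]

/-- the dyadic key of a point -/
def s9key {d : ℕ} (a : Fin d → ℝ) (l : ℝ) (n : ℕ) (x : Euc d) : Fin d → ℤ :=
  fun i => ⌊(x i - a i) / l * 2 ^ n⌋

/-- half open dyadic cube -/
def s9D {d : ℕ} (a : Fin d → ℝ) (l : ℝ) (n : ℕ) (k : Fin d → ℤ) : Set (Euc d) :=
  {y | s9key a l n y = k}

lemma s9_mem_D {d : ℕ} {a : Fin d → ℝ} {l : ℝ} (hl : 0 < l) {n : ℕ} {k : Fin d → ℤ} {y : Euc d} :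
    y ∈ s9D a l n k ↔ ∀ i, a i + k i * (l / 2 ^ n) ≤ y i ∧
      y i < a i + k i * (l / 2 ^ n) + l / 2 ^ n := by
  have hp : (0:ℝ) < 2 ^ n := by positivity
  unfold s9D s9key
  simp only [mem_ofPred_eq, funext_iff, Int.floor_eq_iff]
  refine forall_congr' fun i => ?_
  have e : (y i - a i) / l * 2 ^ n = (y i - a i) / (l / 2 ^ n) := by field_simp
  have hh : 0 < l / 2 ^ n := by positivity
  rw [e, le_div_iff₀ hh, div_lt_iff₀ hh, add_mul]
  constructor <;> rintro ⟨h1, h2⟩ <;> constructor <;> linarith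

lemma s9_D_eq_preimage {d : ℕ} {a : Fin d → ℝ} {l : ℝ} (hl : 0 < l) (n : ℕ) (k : Fin d → ℤ) :
    s9D a l n k = (WithLp.ofLp : Euc d → (Fin d → ℝ)) ⁻¹'
      (Set.univ.pi fun i => Set.Ico (a i + k i * (l / 2 ^ n))
        (a i + k i * (l / 2 ^ n) + l / 2 ^ n)) := by
  ext x; rw [s9_mem_D hl]; simp

lemma s9_measurableSet_D {d : ℕ} {a : Fin d → ℝ} {l : ℝ} (hl : 0 < l) (n : ℕ) (k : Fin d → ℤ) :
    MeasurableSet (s9D a l n k) := by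
  rw [s9_D_eq_preimage hl]
  exact (PiLp.volume_preserving_ofLp (Fin d)).measurable
    (MeasurableSet.univ_pi fun i => measurableSet_Ico)

lemma s9_volume_D {d : ℕ} {a : Fin d → ℝ} {l : ℝ} (hl : 0 < l) (n : ℕ) (k : Fin d → ℤ) :
    volume (s9D a l n k) = ENNReal.ofReal ((l / 2 ^ n) ^ d) := by
  rw [s9_D_eq_preimage hl, (PiLp.volume_preserving_ofLp (Fin d)).measure_preimage
    (MeasurableSet.univ_pi fun i => measurableSet_Ico).nullMeasurableSet]
  rw [volume_pi_pi]
  have : 0 ≤ l / 2 ^ n := by positivity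
  simp [ENNReal.ofReal_pow this]

lemma s9_D_subset_cube {d : ℕ} {a : Fin d → ℝ} {l : ℝ} (hl : 0 < l) (n : ℕ) (k : Fin d → ℤ) :
    s9D a l n k ⊆ cubeSet (fun i => a i + k i * (l / 2 ^ n)) (l / 2 ^ n) := by
  intro y hy
  rw [s9_mem_D hl] at hy
  exact fun i => ⟨(hy i).1, (hy i).2.le⟩

lemma s9_key_succ {d : ℕ} {a : Fin d → ℝ} {l : ℝ} {n : ℕ} {x y : Euc d}
    (h : s9key a l (n+1) x = s9key a l (n+1) y) : s9key a l n x = s9key a l n y := by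
  funext i
  have h1 := congrFun h i
  have key : ∀ z : ℝ, ⌊z * 2 ^ n⌋ = ⌊z * 2 ^ (n+1)⌋ / 2 := by
    intro z
    have := Int.floor_div_natCast (z * 2 ^ (n+1)) 2
    rw [← Nat.cast_ofNat (R := ℤ), ← this]
    congr 1
    push_cast
    rw [pow_succ]; ring
  unfold s9key at h1 ⊢
  rw [key, key, h1]

lemma s9_key_le {d : ℕ} {a : Fin d → ℝ} {l : ℝ} {m n : ℕ} (hmn : m ≤ n) {x y : Euc d}
    (h : s9key a l n x = s9key a l n y) : s9key a l m x = s9key a l m y := by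
  induction n, hmn using Nat.le_induction with
  | base => exact h
  | succ n _ ih => exact ih (s9_key_succ h)

/-- half open version of the base cube -/
def s9H {d : ℕ} (a : Fin d → ℝ) (l : ℝ) : Set (Euc d) := s9D a l 0 0

lemma s9_H_subset {d : ℕ} {a : Fin d → ℝ} {l : ℝ} (hl : 0 < l) :
    s9H a l ⊆ cubeSet a l := by
  have := s9_D_subset_cube (a := a) hl 0 0
  simpa [s9H] using this

lemma s9_volume_diff_H {d : ℕ} {a : Fin d → ℝ} {l : ℝ} (hl : 0 < l) :
    volume (cubeSet a l \ s9H a l) = 0 := by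
  rw [measure_sdiff (s9_H_subset hl) (s9_measurableSet_D hl _ _).nullMeasurableSet
    (by unfold s9H; rw [s9_volume_D hl]; simp)]
  unfold s9H
  rw [s9_volume_D hl, s9_volume_cubeSet a hl.le]; simp

lemma s9_cube_subset {d : ℕ} {a : Fin d → ℝ} {l : ℝ} (hl : 0 < l) {n : ℕ} {x : Euc d}
    (hx : x ∈ s9H a l) :
    cubeSet (fun i => a i + s9key a l n x i * (l / 2 ^ n)) (l / 2 ^ n) ⊆ cubeSet a l := by
  intro y hy i
  have hy := hy i
  have hx0 := ((s9_mem_D hl).1 hx) i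
  have hk := ((s9_mem_D (k := s9key a l n x) hl (n := n) (y := x)).1 rfl) i
  simp only [Pi.zero_apply, Int.cast_zero, zero_mul, add_zero, pow_zero, div_one] at hx0
  have hp : (0:ℝ) < 2 ^ n := by positivity
  have hh : 0 < l / 2 ^ n := by positivity
  have hl' : l = 2 ^ n * (l / 2 ^ n) := by field_simp
  set h := l / 2 ^ n with hhd
  set k := s9key a l n x i
  have k0 : (-1 : ℝ) < k := by
    by_contra hc
    push Not at hc
    nlinarith
  have k1 : (k : ℝ) < 2 ^ n := by
    by_contra hc
    push Not at hc
    nlinarith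
  have k0' : (0:ℤ) ≤ k := by
    have : (-1 : ℤ) < k := by exact_mod_cast k0
    omega
  have k1' : k + 1 ≤ (2:ℤ) ^ n := by
    have : k < (2:ℤ)^n := by exact_mod_cast k1
    omega
  have k0r : (0:ℝ) ≤ k := by exact_mod_cast k0'
  have k1r : (k:ℝ) + 1 ≤ 2 ^ n := by exact_mod_cast k1'
  constructor
  · nlinarith [hy.1]
  · have := hy.2
    nlinarith

/-- selection criterion -/
def s9sel {d : ℕ} (a : Fin d → ℝ) (l : ℝ) (Ω : Set (Euc d)) (n : ℕ) (k : Fin d → ℤ) : Prop :=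
  volume (s9D a l n k) < 2 ^ (d+1) * volume (s9D a l n k ∩ Ω)

lemma s9_density {d : ℕ} (hd : 0 < d) {a : Fin d → ℝ} {l : ℝ} (hl : 0 < l) (Ω : Set (Euc d)) :
    ∀ᵐ x ∂(volume.restrict Ω), ∃ n, s9sel a l Ω n (s9key a l n x) := by
  filter_upwards [Besicovitch.ae_tendsto_measure_inter_div (volume : Measure (Euc d)) Ω] with x hx
  by_contra hc
  push Not at hc
  unfold s9sel at hc
  have hdr : (0:ℝ) < √d := Real.sqrt_pos.2 (by exact_mod_cast hd)
  set r : ℕ → ℝ := fun n => √d * (l / 2 ^ n) with hr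
  have hrpos : ∀ n, 0 < r n := fun n => by simp only [hr]; positivity
  have hrlim : Tendsto r atTop (nhdsWithin 0 (Ioi 0)) := by
    refine tendsto_nhdsWithin_iff.2 ⟨?_, Eventually.of_forall hrpos⟩
    have h1 : Tendsto (fun n : ℕ => (1/2 : ℝ) ^ n) atTop (nhds 0) :=
      tendsto_pow_atTop_nhds_zero_of_lt_one (by norm_num) (by norm_num)
    have h2 := h1.const_mul (√d * l)
    rw [mul_zero] at h2
    refine h2.congr fun n => ?_
    simp only [hr, one_div, inv_pow]; ring
  have hlim := hx.comp hrlim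
  set M : ℝ≥0∞ := ENNReal.ofReal (√d ^ d) * volume (Metric.ball (0 : Euc d) 1) with hM
  have hMtop : M ≠ ∞ := ENNReal.mul_ne_top (by simp) (measure_ball_lt_top).ne
  have hvB : ∀ n, volume (Metric.closedBall x (r n)) =
      M * volume (s9D a l n (s9key a l n x)) := by
    intro n
    rw [Measure.addHaar_closedBall _ _ (hrpos n).le, s9_volume_D hl]
    simp only [hr, mul_pow, finrank_euclideanSpace, Fintype.card_fin]
    rw [ENNReal.ofReal_mul (by positivity), hM]; ring
  have hsub : ∀ n, s9D a l n (s9key a l n x) ⊆ Metric.closedBall x (r n) := by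
    intro n y hy
    have h1 := (s9_mem_D hl).1 hy
    have h2 := ((s9_mem_D (k := s9key a l n x) hl (n := n) (y := x)).1 rfl)
    rw [Metric.mem_closedBall, EuclideanSpace.dist_eq]
    have hh : 0 < l / 2 ^ n := by positivity
    have : ∑ i, dist (y i) (x i) ^ 2 ≤ d * (l / 2 ^ n) ^ 2 := by
      calc ∑ i, dist (y i) (x i) ^ 2 ≤ ∑ i : Fin d, (l / 2 ^ n) ^ 2 := by
            refine Finset.sum_le_sum fun i _ => ?_
            refine pow_le_pow_left₀ dist_nonneg ?_ 2
            rw [Real.dist_eq, abs_le]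
            have := h1 i; have := h2 i
            constructor <;> linarith
        _ = _ := by simp
    calc _ ≤ √(d * (l / 2 ^ n) ^ 2) := Real.sqrt_le_sqrt this
      _ = r n := by rw [Real.sqrt_mul (by positivity), Real.sqrt_sq hh.le]
  have hineq : ∀ n, volume (Ω ∩ Metric.closedBall x (r n)) / volume (Metric.closedBall x (r n))
      + 2⁻¹ * M⁻¹ ≤ 1 := by
    intro n
    set D := s9D a l n (s9key a l n x)
    set B := Metric.closedBall x (r n)
    have hD0 : volume D ≠ 0 := by
      rw [s9_volume_D hl]
      simp only [ne_eq, ENNReal.ofReal_eq_zero, not_le]; positivity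
    have hDt : volume D ≠ ∞ := by rw [s9_volume_D hl]; simp
    have hB0 : volume B ≠ 0 := fun h => hD0 (measure_mono_null (hsub n) h)
    have hBt : volume B ≠ ∞ := measure_closedBall_lt_top.ne
    have h1 : volume (D ∩ Ω) ≤ 2⁻¹ * volume D := by
      have h2 : 2 * volume (D ∩ Ω) ≤ volume D := by
        refine le_trans ?_ (not_lt.1 (hc n))
        gcongr
        calc (2:ℝ≥0∞) = 2 ^ 1 := by simp
          _ ≤ 2 ^ (d+1) := pow_le_pow_right₀ (by norm_num) (by omega)
      calc volume (D ∩ Ω) = 2⁻¹ * (2 * volume (D ∩ Ω)) := by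
            rw [← mul_assoc, ENNReal.inv_mul_cancel (by simp) (by simp), one_mul]
        _ ≤ _ := by gcongr
    have h3 : volume (Ω ∩ B) + 2⁻¹ * volume D ≤ volume B := by
      calc volume (Ω ∩ B) + 2⁻¹ * volume D ≤ (volume (D ∩ Ω) + volume (B \ D)) + 2⁻¹ * volume D := by
            gcongr
            refine (measure_mono ?_).trans (measure_union_le _ _)
            intro z hz
            by_cases hzD : z ∈ D
            · exact Or.inl ⟨hzD, hz.1⟩
            · exact Or.inr ⟨hz.2, hzD⟩
        _ ≤ (2⁻¹ * volume D + volume (B \ D)) + 2⁻¹ * volume D := by gcongr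
        _ = (2⁻¹ + 2⁻¹) * volume D + volume (B \ D) := by ring
        _ = volume D + volume (B \ D) := by rw [ENNReal.inv_two_add_inv_two, one_mul]
        _ = volume B := by
            rw [← measure_union disjoint_sdiff_right
              (measurableSet_closedBall.diff (s9_measurableSet_D hl _ _)),
              Set.union_sdiff_cancel (hsub n)]
    have h4 : M⁻¹ = volume D / volume B := by
      rw [hvB n, mul_comm M, ENNReal.div_eq_inv_mul,
        ENNReal.mul_inv (Or.inl hD0) (Or.inl hDt), mul_comm (volume D)⁻¹, mul_assoc,
        ENNReal.inv_mul_cancel hD0 hDt, mul_one]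
    rw [h4, ← mul_div_assoc, ENNReal.div_add_div_same]
    exact ENNReal.div_le_of_le_mul (by rwa [one_mul])
  have hl2 := hlim.add_const (2⁻¹ * M⁻¹)
  have h5 : (1:ℝ≥0∞) + 2⁻¹ * M⁻¹ ≤ 1 := le_of_tendsto' hl2 hineq
  have h6 : (2⁻¹ * M⁻¹ : ℝ≥0∞) ≠ 0 := mul_ne_zero (by simp) (ENNReal.inv_ne_zero.2 hMtop)
  have := ENNReal.lt_add_right one_ne_top h6
  exact absurd h5 (not_le.2 this)

lemma s9_lint_osc {d : ℕ} {b : Fin d → ℝ} {h : ℝ} (hh : 0 < h)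
    {f : Euc d → ℝ} (hfi : IntegrableOn f (cubeSet b h)) (c : ℝ) :
    ∫⁻ y in cubeSet b h, ENNReal.ofReal |f y - c| =
      ENNReal.ofReal (⨍ y in cubeSet b h, |f y - c|) * volume (cubeSet b h) := by
  have hvt : volume (cubeSet b h) ≠ ∞ := by rw [s9_volume_cubeSet b hh.le]; simp
  have hi : IntegrableOn (fun y => |f y - c|) (cubeSet b h) :=
    (hfi.sub (integrableOn_const hvt)).abs
  rw [← ofReal_integral_eq_lintegral_ofReal hi (Eventually.of_forall fun y => abs_nonneg _)]
  rw [setAverage_eq, smul_eq_mul, measureReal_def]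
  have hv0 : 0 < (volume (cubeSet b h)).toReal := by
    rw [s9_volume_cubeSet b hh.le, ENNReal.toReal_ofReal (by positivity)]; positivity
  have hve : volume (cubeSet b h) = ENNReal.ofReal (volume (cubeSet b h)).toReal :=
    (ENNReal.ofReal_toReal hvt).symm
  generalize (volume (cubeSet b h)).toReal = v at hv0 hve ⊢
  rw [hve, ← ENNReal.ofReal_mul' hv0.le]
  congr 1
  field_simp

lemma s9_osc_le {d : ℕ} {Q0 : Set (Euc d)} {b : Fin d → ℝ} {h : ℝ} (hh : 0 < h)
    (hsub : cubeSet b h ⊆ Q0) {f : Euc d → ℝ}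
    {x : Euc d} (hx : x ∈ cubeSet b h) :
    ENNReal.ofReal (⨍ y in cubeSet b h, |f y - ⨍ z in cubeSet b h, f z|) ≤
      sharpLocal volume Q0 f x := by
  unfold sharpLocal
  exact le_iSup₂_of_le (cubeSet b h) ⟨⟨b, h, hh, rfl⟩, hx, hsub⟩ le_rfl

lemma s9_cheb {d : ℕ} {Q0 : Set (Euc d)} {b : Fin d → ℝ} {h : ℝ} (hh : 0 < h)
    (hsub : cubeSet b h ⊆ Q0) {f : Euc d → ℝ} (hf : Measurable f) (hfi : IntegrableOn f Q0)
    {x : Euc d} (hx : x ∈ cubeSet b h) {β : ℝ} (hβ : 0 < β)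
    (hs : sharpLocal volume Q0 f x ≤ ENNReal.ofReal β) {c : ℝ} (hc : 0 < c) :
    ENNReal.ofReal c * volume {y ∈ cubeSet b h | c * β ≤ |f y - ⨍ z in cubeSet b h, f z|} ≤
      volume (cubeSet b h) := by
  set m := ⨍ z in cubeSet b h, f z with hm
  have h1 := (s9_osc_le hh hsub (f := f) hx).trans hs
  rw [← hm] at h1
  have h2 := s9_lint_osc hh (hfi.mono_set hsub) m
  have h3 : ENNReal.ofReal (c * β) * volume.restrict (cubeSet b h)
      {y | ENNReal.ofReal (c * β) ≤ ENNReal.ofReal |f y - m|} ≤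
      ∫⁻ y in cubeSet b h, ENNReal.ofReal |f y - m| :=
    mul_meas_ge_le_lintegral₀ (by fun_prop) _
  rw [h2] at h3
  have h4 : ENNReal.ofReal (c * β) * volume {y ∈ cubeSet b h | c * β ≤ |f y - m|} ≤
      ENNReal.ofReal β * volume (cubeSet b h) := by
    refine le_trans (le_trans ?_ h3) (by gcongr)
    refine mul_le_mul_right ?_ _
    rw [Measure.restrict_apply' (s9_measurableSet_cubeSet b h)]
    refine measure_mono fun y hy => ⟨?_, hy.1⟩
    exact ENNReal.ofReal_le_ofReal hy.2
  rw [ENNReal.ofReal_mul hc.le, mul_comm (ENNReal.ofReal c), mul_assoc] at h4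
  exact (ENNReal.mul_le_mul_iff_right (by simpa using hβ) (by simp)).1 h4

lemma s9_cz {d : ℕ} (hd : 0 < d) {a : Fin d → ℝ} {l : ℝ} (hl : 0 < l)
    {f : Euc d → ℝ} (hf : Measurable f) (hfi : IntegrableOn f (cubeSet a l))
    {α β A : ℝ} (hβ : 0 < β) (hA : 0 < A) {Ω : Set (Euc d)}
    (hΩ1 : {x ∈ cubeSet a l | α < |f x|} ⊆ Ω)
    (hΩ2 : {x ∈ cubeSet a l | ENNReal.ofReal β < sharpLocal volume (cubeSet a l) f x} ⊆ Ω)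
    (hΩ : 2 ^ (d+1) * volume Ω ≤ volume (cubeSet a l)) :
    ENNReal.ofReal A * volume {x ∈ cubeSet a l | α + (3 + A) * β < |f x|} ≤
      2 ^ (d+1) * volume Ω := by
  set E := {x ∈ cubeSet a l | α + (3 + A) * β < |f x|} with hE
  have hEΩ : E ⊆ Ω := by
    refine fun x hx => hΩ1 ⟨hx.1, ?_⟩
    have := hx.2
    nlinarith [mul_pos (show 0 < 3 + A by linarith) hβ]
  set S : Set (ℕ × (Fin d → ℤ)) := {q | ∃ x ∈ s9H a l, q.2 = s9key a l q.1 x ∧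
    s9sel a l Ω q.1 q.2 ∧ ∀ m < q.1, ¬ s9sel a l Ω m (s9key a l m x)} with hS
  let D : ℕ × (Fin d → ℤ) → Set (Euc d) := fun q => s9D a l q.1 q.2
  have hcount : S.Countable := S.to_countable
  have hDm : ∀ q, MeasurableSet (D q) := fun q => s9_measurableSet_D hl _ _
  have hdisj : S.PairwiseDisjoint D := by
    have key : ∀ q ∈ S, ∀ q' ∈ S, ∀ z, z ∈ D q → z ∈ D q' → q.1 ≤ q'.1 → q = q' := by
      rintro ⟨n, k⟩ ⟨x, hx, hk, hs, hmin⟩ ⟨n', k'⟩ ⟨x', hx', hk', hs', hmin'⟩ z hz hz' hle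
      simp only at hk hk' hs hs' hmin hmin' hle
      have hz1 : s9key a l n z = k := hz
      have hz2 : s9key a l n' z = k' := hz'
      have h1 : s9key a l n z = s9key a l n x' := s9_key_le hle (hz2.trans hk')
      rcases hle.lt_or_eq with hlt | heq
      · exact absurd (by rwa [← h1, hz1]) (hmin' n hlt)
      · subst heq
        rw [← hz1, ← hz2]
    intro q hq q' hq' hne
    rw [Function.onFun, Set.disjoint_left]
    intro z hz hz'
    rcases le_total q.1 q'.1 with h | h
    · exact hne (key q hq q' hq' z hz hz' h)
    · exact hne (key q' hq' q hq z hz' hz h).symm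
  have hcube : ∀ q ∈ S, ENNReal.ofReal A * volume (E ∩ D q) ≤ 2 ^ (d+1) * volume (Ω ∩ D q) := by
    rintro ⟨n, k⟩ ⟨x, hx, hk, hs, hmin⟩
    simp only at hk hs hmin
    subst hk
    show ENNReal.ofReal A * volume (E ∩ s9D a l n _) ≤ 2 ^ (d+1) * volume (Ω ∩ s9D a l n _)
    have hn : n ≠ 0 := by
      rintro rfl
      unfold s9sel at hs
      refine absurd hs (not_lt.2 ?_)
      calc 2 ^ (d+1) * volume (s9D a l 0 (s9key a l 0 x) ∩ Ω) ≤ 2 ^ (d+1) * volume Ω := by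
            gcongr; exact inter_subset_right
        _ ≤ _ := hΩ
        _ = _ := by rw [s9_volume_D hl, s9_volume_cubeSet _ hl.le]; simp
    obtain ⟨m, rfl⟩ := Nat.exists_eq_succ_of_ne_zero hn
    have hpar := not_lt.1 (hmin m (Nat.lt_succ_self m))
    set D1 := s9D a l (m+1) (s9key a l (m+1) x) with hD1
    set Q := cubeSet (fun i => a i + s9key a l (m+1) x i * (l / 2 ^ (m+1))) (l / 2 ^ (m+1)) with hQ
    have hh : 0 < l / 2 ^ (m+1) := by positivity
    have hDQ : D1 ⊆ Q := s9_D_subset_cube hl _ _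
    have hQ0 : Q ⊆ cubeSet a l := s9_cube_subset hl hx
    have hvDQ : volume Q = volume D1 := by
      rw [hQ, hD1, s9_volume_D hl, s9_volume_cubeSet _ hh.le]
    have hD0 : volume D1 ≠ 0 := by
      rw [s9_volume_D hl]
      simp only [ne_eq, ENNReal.ofReal_eq_zero, not_le]; positivity
    have hDt : volume D1 ≠ ∞ := by rw [s9_volume_D hl]; simp
    have hhalf : 2 * volume (D1 ∩ Ω) ≤ volume D1 := by
      have h1 : D1 ⊆ s9D a l m (s9key a l m x) := fun y hy => s9_key_succ hy
      have h2 : volume (s9D a l m (s9key a l m x)) = 2 ^ d * volume D1 := by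
        rw [hD1, s9_volume_D hl, s9_volume_D hl]
        rw [show (2:ℝ≥0∞) ^ d = ENNReal.ofReal (2 ^ d) by simp [ENNReal.ofReal_pow],
          ← ENNReal.ofReal_mul (by positivity), ← mul_pow]
        congr 2; rw [pow_succ]; field_simp
      rw [h2, pow_succ, mul_assoc] at hpar
      have h3 := (ENNReal.mul_le_mul_iff_right (by simp) (by simp)).1 hpar
      exact le_trans (by gcongr) h3
    have hex1 : ∃ z ∈ D1, z ∉ Ω := by
      by_contra hcon
      push Not at hcon
      have : D1 ∩ Ω = D1 := inter_eq_left.2 hcon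
      rw [this] at hhalf
      have h2 : volume D1 < 2 * volume D1 := by
        rw [two_mul]; exact ENNReal.lt_add_right hDt hD0
      exact absurd hhalf (not_le.2 h2)
    obtain ⟨z, hz, hzΩ⟩ := hex1
    have hsz : sharpLocal volume (cubeSet a l) f z ≤ ENNReal.ofReal β := by
      by_contra hcon
      exact hzΩ (hΩ2 ⟨hQ0 (hDQ hz), not_le.1 hcon⟩)
    have cheb := fun {c : ℝ} (hc : 0 < c) => s9_cheb hh hQ0 hf hfi (hDQ hz) hβ hsz hc
    rw [← hQ] at cheb
    set fQ := ⨍ z in Q, f z with hfQ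
    have hex2 : ∃ w ∈ D1, w ∉ Ω ∧ |f w - fQ| < 3 * β := by
      by_contra hcon
      push Not at hcon
      have h1 : volume D1 ≤ volume (D1 ∩ Ω) + volume {y ∈ Q | 3 * β ≤ |f y - fQ|} := by
        refine (measure_mono ?_).trans (measure_union_le _ _)
        intro w hw
        by_cases hwΩ : w ∈ Ω
        · exact Or.inl ⟨hw, hwΩ⟩
        · exact Or.inr ⟨hDQ hw, hcon w hw hwΩ⟩
      have h2 := cheb (c := 3) (by norm_num)
      rw [hvDQ, show ENNReal.ofReal 3 = 3 by simp] at h2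
      set p := volume (D1 ∩ Ω)
      set r := volume {y ∈ Q | 3 * β ≤ |f y - fQ|}
      have h3 : 6 * volume D1 ≤ 5 * volume D1 := by
        calc 6 * volume D1 ≤ 6 * (p + r) := by gcongr
          _ = 3 * (2 * p) + 2 * (3 * r) := by ring
          _ ≤ 3 * volume D1 + 2 * volume D1 := by gcongr
          _ = 5 * volume D1 := by ring
      rw [ENNReal.mul_le_mul_iff_left hD0 hDt] at h3
      norm_num at h3
    obtain ⟨w, hw, hwΩ, hwf⟩ := hex2
    have hwα : |f w| ≤ α := by
      by_contra hcon
      exact hwΩ (hΩ1 ⟨hQ0 (hDQ hw), not_le.1 hcon⟩)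
    have hsubE : E ∩ D1 ⊆ {y ∈ Q | A * β ≤ |f y - fQ|} := by
      rintro y ⟨hy, hyD⟩
      refine ⟨hDQ hyD, ?_⟩
      have h1 := hy.2
      have h2 : |f y| ≤ |f y - fQ| + |f w - fQ| + |f w| := by
        have e : f y = (f y - fQ) - (f w - fQ) + f w := by ring
        calc |f y| = |(f y - fQ) - (f w - fQ) + f w| := by rw [← e]
          _ ≤ |(f y - fQ) - (f w - fQ)| + |f w| := abs_add_le _ _
          _ ≤ _ := by gcongr; exact abs_sub _ _
      nlinarith
    calc ENNReal.ofReal A * volume (E ∩ D1) ≤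
          ENNReal.ofReal A * volume {y ∈ Q | A * β ≤ |f y - fQ|} := by gcongr
      _ ≤ volume Q := cheb hA
      _ = volume D1 := hvDQ
      _ ≤ 2 ^ (d+1) * volume (D1 ∩ Ω) := hs.le
      _ = _ := by rw [inter_comm]
  -- covering
  have hcov : volume (E \ ⋃ q ∈ S, D q) = 0 := by
    have hdens := s9_density hd (a := a) hl Ω
    rw [ae_iff] at hdens
    have h1 : volume ({x | ¬ ∃ n, s9sel a l Ω n (s9key a l n x)} ∩ Ω) = 0 :=
      le_antisymm ((Measure.le_restrict_apply _ _).trans hdens.le) zero_le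
    refine measure_mono_null (t := ({x | ¬ ∃ n, s9sel a l Ω n (s9key a l n x)} ∩ Ω) ∪
      (cubeSet a l \ s9H a l)) ?_ (measure_union_null h1 (s9_volume_diff_H hl))
    rintro x ⟨hxE, hxU⟩
    by_cases hxH : x ∈ s9H a l
    · left
      refine ⟨?_, hEΩ hxE⟩
      intro hex
      classical
      apply hxU
      refine mem_biUnion (x := (Nat.find hex, s9key a l (Nat.find hex) x)) ?_ rfl
      exact ⟨x, hxH, rfl, Nat.find_spec hex, fun m hm => Nat.find_min hex hm⟩
    · exact Or.inr ⟨hxE.1, hxH⟩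
  have hsum : ∀ G : Set (Euc d), volume (G ∩ ⋃ q ∈ S, D q) = ∑' q : S, volume (G ∩ D q) := by
    intro G
    have h1 := measure_biUnion (μ := volume.restrict G) hcount hdisj (fun q _ => hDm q)
    rw [Measure.restrict_apply (MeasurableSet.biUnion hcount fun q _ => hDm q), inter_comm] at h1
    rw [h1]
    refine tsum_congr fun q => ?_
    rw [Measure.restrict_apply (hDm q), inter_comm]
  calc ENNReal.ofReal A * volume E ≤
        ENNReal.ofReal A * (volume (E ∩ ⋃ q ∈ S, D q) + volume (E \ ⋃ q ∈ S, D q)) := by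
          gcongr; exact measure_le_inter_add_sdiff _ _ _
    _ = ∑' q : S, ENNReal.ofReal A * volume (E ∩ D q) := by
          rw [hcov, add_zero, hsum, ENNReal.tsum_mul_left]
    _ ≤ ∑' q : S, 2 ^ (d+1) * volume (Ω ∩ D q) :=
          ENNReal.tsum_le_tsum fun q => hcube q q.2
    _ = 2 ^ (d+1) * volume (Ω ∩ ⋃ q ∈ S, D q) := by rw [ENNReal.tsum_mul_left, hsum]
    _ ≤ 2 ^ (d+1) * volume Ω := by gcongr; exact inter_subset_left

lemma s9_rearr_antitone {α : Type*} [MeasurableSpace α] (μ : Measure α) (g : α → ℝ≥0∞) :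
    Antitone (rearr μ g) := by
  intro s t hst
  exact sInf_le_sInf fun l hl => le_trans hl (ENNReal.ofReal_le_ofReal hst)

lemma s9_rearr_le {α : Type*} [MeasurableSpace α] {μ : Measure α} {g : α → ℝ≥0∞} {t : ℝ}
    {c : ℝ≥0∞} (h : μ {x | c < g x} ≤ ENNReal.ofReal t) : rearr μ g t ≤ c := sInf_le h

lemma s9_le_rearr {α : Type*} [MeasurableSpace α] {μ : Measure α} {g : α → ℝ≥0∞} {t : ℝ}
    {c : ℝ≥0∞} (h : ∀ b < c, ENNReal.ofReal t < μ {x | b < g x}) : c ≤ rearr μ g t := by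
  refine le_sInf fun b hb => ?_
  by_contra hc
  exact absurd (h b (not_le.1 hc)) (not_lt.2 hb)

lemma s9_lt_of_lt_rearr {α : Type*} [MeasurableSpace α] {μ : Measure α} {g : α → ℝ≥0∞} {t : ℝ}
    {c : ℝ≥0∞} (h : c < rearr μ g t) : ENNReal.ofReal t < μ {x | c < g x} := by
  by_contra hc
  exact absurd h (not_lt.2 (s9_rearr_le (not_lt.1 hc)))

lemma s9_meas_of_rearr_lt {α : Type*} [MeasurableSpace α] {μ : Measure α} {g : α → ℝ≥0∞} {t : ℝ}
    {c : ℝ≥0∞} (h : rearr μ g t < c) : μ {x | c < g x} ≤ ENNReal.ofReal t := by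
  obtain ⟨b, hb, hbc⟩ := sInf_lt_iff.1 h
  exact (measure_mono fun x hx => hbc.trans hx).trans hb

lemma s9_meas_rearr {α : Type*} [MeasurableSpace α] {μ : Measure α} {g : α → ℝ≥0∞} {t : ℝ} :
    μ {x | rearr μ g t < g x} ≤ ENNReal.ofReal t := by
  rcases eq_or_ne (rearr μ g t) ∞ with htop | htop
  · rw [htop]; simp
  obtain ⟨u, hu, hgt, hlim⟩ := exists_seq_strictAnti_tendsto' (lt_top_iff_ne_top.2 htop)
  have h1 : {x | rearr μ g t < g x} = ⋃ n, {x | u n < g x} := by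
    ext x
    simp only [mem_ofPred_eq, mem_iUnion]
    constructor
    · intro hx
      exact ((hlim.eventually (gt_mem_nhds hx)).exists)
    · rintro ⟨n, hn⟩
      exact (hgt n).1.trans hn
  have hmono : Monotone fun n => {x | u n < g x} := by
    intro m n hmn x hx
    exact lt_of_le_of_lt (hu.antitone hmn) hx
  rw [h1, hmono.measure_iUnion]
  exact iSup_le fun n => s9_meas_of_rearr_lt (hgt n).1

lemma s9_sharp_sub {d : ℕ} {Q0 : Set (Euc d)} {f : Euc d → ℝ} (hfi : IntegrableOn f Q0)
    (m : ℝ) (x : Euc d) :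
    sharpLocal volume Q0 (fun y => f y - m) x = sharpLocal volume Q0 f x := by
  unfold sharpLocal
  refine iSup_congr fun Q => iSup_congr fun hQ => ?_
  obtain ⟨⟨b, h, hh, rfl⟩, -, hsub⟩ := hQ
  have hvt : volume (cubeSet b h) ≠ ∞ := by rw [s9_volume_cubeSet b hh.le]; simp
  have hv0 : volume (cubeSet b h) ≠ 0 := by
    rw [s9_volume_cubeSet b hh.le]
    simp only [ne_eq, ENNReal.ofReal_eq_zero, not_le]; positivity
  have h1 : ⨍ z in cubeSet b h, (f z - m) = (⨍ z in cubeSet b h, f z) - m := by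
    rw [setAverage_eq, setAverage_eq, integral_sub (hfi.mono_set hsub) (integrableOn_const hvt)]
    simp only [smul_eq_mul, setIntegral_const, mul_sub]
    congr 1
    have : volume.real (cubeSet b h) ≠ 0 := by
      rw [measureReal_def]; exact (ENNReal.toReal_pos hv0 hvt).ne'
    field_simp
  rw [h1]
  simp

lemma s9_R {d : ℕ} (hd : 0 < d) {a : Fin d → ℝ} {l : ℝ} (hl : 0 < l)
    {f : Euc d → ℝ} (hf : Measurable f) (hfi : IntegrableOn f (cubeSet a l)) (m : ℝ)
    {t : ℝ} (ht : 0 < t) (htl : t ≤ l ^ d / (3 * 2 ^ (d+1))) :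
    rearrR (volume.restrict (cubeSet a l)) (fun x => f x - m) t ≤
      rearrR (volume.restrict (cubeSet a l)) (fun x => f x - m) (2 * t) +
      ENNReal.ofReal (3 + 3 * 2 ^ (d+1)) *
        rearr (volume.restrict (cubeSet a l)) (sharpLocal volume (cubeSet a l) f) t := by
  set μ := volume.restrict (cubeSet a l) with hμ
  set φ := rearrR μ (fun x => f x - m) with hφ
  set ψ := rearr μ (sharpLocal volume (cubeSet a l) f) with hψ
  have hAp : (0:ℝ) < 3 + 3 * 2 ^ (d+1) := by positivity
  rcases eq_or_ne (φ (2*t)) ∞ with h1 | h1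
  · rw [h1]; simp
  rcases eq_or_ne (ψ t) ∞ with h2 | h2
  · rw [h2, ENNReal.mul_top (by simpa using hAp)]; simp
  refine ENNReal.le_of_forall_pos_le_add fun ε hε _ => ?_
  set α := (φ (2*t)).toReal with hα
  set β := (ψ t).toReal + ε / (3 + 3 * 2 ^ (d+1)) with hβ
  have hε' : (0:ℝ) < ε := hε
  have hβpos : 0 < β := by
    have : 0 ≤ (ψ t).toReal := ENNReal.toReal_nonneg
    have : 0 < ε / (3 + 3 * 2 ^ (d+1) : ℝ) := by positivity
    linarith
  have hψβ : ψ t ≤ ENNReal.ofReal β := by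
    rw [← ENNReal.ofReal_toReal h2]
    apply ENNReal.ofReal_le_ofReal
    have : 0 < ε / (3 + 3 * 2 ^ (d+1) : ℝ) := by positivity
    linarith
  have hφα : φ (2*t) = ENNReal.ofReal α := (ENNReal.ofReal_toReal h1).symm
  have hα0 : 0 ≤ α := ENNReal.toReal_nonneg
  have hgi : IntegrableOn (fun x => f x - m) (cubeSet a l) :=
    hfi.sub (integrableOn_const (by rw [s9_volume_cubeSet a hl.le]; simp))
  have hcz := s9_cz hd hl (f := fun x => f x - m) (hf.sub_const m) hgi (α := α) (β := β)
    (A := 3 * 2 ^ (d+1)) hβpos (by positivity) (Ω := _) subset_union_left subset_union_right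
  have hE1 : volume {x ∈ cubeSet a l | α < |f x - m|} ≤ ENNReal.ofReal (2 * t) := by
    refine le_trans (le_of_eq ?_) (s9_meas_rearr (μ := μ)
      (g := fun x => ENNReal.ofReal |f x - m|) (t := 2 * t))
    rw [hμ, Measure.restrict_apply' (s9_measurableSet_cubeSet a l)]
    congr 1
    ext x
    have : rearr μ (fun x => ENNReal.ofReal |f x - m|) (2*t) = ENNReal.ofReal α := hφα
    simp only [mem_inter_iff, mem_ofPred_eq]
    rw [← hμ, this, ENNReal.ofReal_lt_ofReal_iff_of_nonneg hα0, and_comm]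
  have hE2 : volume {x ∈ cubeSet a l | ENNReal.ofReal β <
      sharpLocal volume (cubeSet a l) (fun x => f x - m) x} ≤ ENNReal.ofReal t := by
    refine le_trans ?_ (s9_meas_rearr (μ := μ)
      (g := sharpLocal volume (cubeSet a l) f) (t := t))
    rw [hμ, Measure.restrict_apply' (s9_measurableSet_cubeSet a l)]
    refine measure_mono fun x hx => ⟨?_, hx.1⟩
    have h3 := hx.2
    rw [s9_sharp_sub hfi] at h3
    exact lt_of_le_of_lt hψβ h3
  set Ω := {x ∈ cubeSet a l | α < |f x - m|} ∪ {x ∈ cubeSet a l | ENNReal.ofReal β <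
      sharpLocal volume (cubeSet a l) (fun x => f x - m) x} with hΩd
  have hΩ : volume Ω ≤ ENNReal.ofReal (3 * t) := by
    refine (measure_union_le _ _).trans ((add_le_add hE1 hE2).trans ?_)
    rw [← ENNReal.ofReal_add (by positivity) ht.le]
    apply ENNReal.ofReal_le_ofReal; linarith
  have h2p : (2:ℝ≥0∞) ^ (d+1) = ENNReal.ofReal (2 ^ (d+1)) := by simp [ENNReal.ofReal_pow]
  have hΩ' : 2 ^ (d+1) * volume Ω ≤ volume (cubeSet a l) := by
    rw [s9_volume_cubeSet a hl.le, h2p]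
    calc _ ≤ ENNReal.ofReal (2 ^ (d+1)) * ENNReal.ofReal (3 * t) := by gcongr
      _ = ENNReal.ofReal (2 ^ (d+1) * (3 * t)) := (ENNReal.ofReal_mul (by positivity)).symm
      _ ≤ _ := by
        apply ENNReal.ofReal_le_ofReal
        rw [le_div_iff₀ (by positivity)] at htl
        linarith
  have hfin := hcz hΩ'
  have hEle : volume {x ∈ cubeSet a l | α + (3 + 3 * 2 ^ (d+1)) * β < |f x - m|} ≤
      ENNReal.ofReal t := by
    have h4 : ENNReal.ofReal (3 * 2 ^ (d+1)) *
        volume {x ∈ cubeSet a l | α + (3 + 3 * 2 ^ (d+1)) * β < |f x - m|} ≤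
        ENNReal.ofReal (3 * 2 ^ (d+1)) * ENNReal.ofReal t := by
      refine hfin.trans ?_
      rw [h2p]
      calc _ ≤ ENNReal.ofReal (2 ^ (d+1)) * ENNReal.ofReal (3 * t) := by gcongr
        _ = ENNReal.ofReal (2 ^ (d+1) * (3 * t)) := (ENNReal.ofReal_mul (by positivity)).symm
        _ = _ := by rw [← ENNReal.ofReal_mul (by positivity)]; congr 1; ring
    refine (ENNReal.mul_le_mul_iff_right ?_ ENNReal.ofReal_ne_top).1 h4
    simp only [ne_eq, ENNReal.ofReal_eq_zero, not_le]; positivity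
  have hle : φ t ≤ ENNReal.ofReal (α + (3 + 3 * 2 ^ (d+1)) * β) := by
    refine s9_rearr_le ?_
    rw [hμ, Measure.restrict_apply' (s9_measurableSet_cubeSet a l)]
    refine le_trans (measure_mono ?_) hEle
    rintro x ⟨hx1, hx2⟩
    refine ⟨hx2, ?_⟩
    exact (ENNReal.ofReal_lt_ofReal_iff_of_nonneg (by positivity)).1 hx1
  refine hle.trans (le_of_eq ?_)
  rw [hφα]
  have e1 : ψ t = ENNReal.ofReal (ψ t).toReal := (ENNReal.ofReal_toReal h2).symm
  have h0 : 0 ≤ (ψ t).toReal := ENNReal.toReal_nonneg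
  rw [e1, ← ENNReal.ofReal_mul hAp.le, ← ENNReal.ofReal_add hα0 (by positivity),
    ← ENNReal.ofReal_coe_nnreal, ← ENNReal.ofReal_add (by positivity) hε'.le]
  congr 1
  rw [hβ]; field_simp; ring

lemma s9_S {d : ℕ} {a : Fin d → ℝ} {l : ℝ} (hl : 0 < l)
    {f : Euc d → ℝ} (hf : Measurable f) (hfi : IntegrableOn f (cubeSet a l))
    {t v : ℝ} (ht : 0 < t) (hv : v < l ^ d) :
    rearrR (volume.restrict (cubeSet a l)) (fun x => f x - ⨍ z in cubeSet a l, f z) t ≤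
      ENNReal.ofReal (l ^ d / t) *
        rearr (volume.restrict (cubeSet a l)) (sharpLocal volume (cubeSet a l) f) v := by
  set m := ⨍ z in cubeSet a l, f z with hm
  set K := ENNReal.ofReal (⨍ y in cubeSet a l, |f y - m|) with hK
  have h1 : K ≤ rearr (volume.restrict (cubeSet a l)) (sharpLocal volume (cubeSet a l) f) v := by
    refine s9_le_rearr fun b hb => ?_
    rw [Measure.restrict_apply' (s9_measurableSet_cubeSet a l)]
    have : {x | b < sharpLocal volume (cubeSet a l) f x} ∩ cubeSet a l = cubeSet a l := by
      refine inter_eq_right.2 fun x hx => ?_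
      exact lt_of_lt_of_le hb (s9_osc_le hl subset_rfl hx)
    rw [this, s9_volume_cubeSet a hl.le]
    exact (ENNReal.ofReal_lt_ofReal_iff (by positivity)).2 hv
  refine le_trans ?_ (mul_le_mul_right h1 _)
  have h2 := s9_lint_osc hl hfi m
  rw [← hK, s9_volume_cubeSet a hl.le] at h2
  refine le_of_forall_lt_imp_le_of_dense fun c hc => ?_
  have h3 := s9_lt_of_lt_rearr hc
  have h4 : c * ENNReal.ofReal t ≤ K * ENNReal.ofReal (l ^ d) := by
    rw [← h2]
    refine le_trans ?_ (mul_meas_ge_le_lintegral₀ (μ := volume.restrict (cubeSet a l))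
      (f := fun y => ENNReal.ofReal |f y - m|) (by fun_prop) c)
    refine mul_le_mul_right (h3.le.trans (measure_mono ?_)) _
    intro x (hx : c < ENNReal.ofReal |f x - m|)
    exact hx.le
  rw [ENNReal.ofReal_div_of_pos ht, ← ENNReal.mul_div_right_comm]
  rw [ENNReal.le_div_iff_mul_le (Or.inl (by simpa using ht)) (Or.inl (by simp))]
  rwa [mul_comm (ENNReal.ofReal (l ^ d))]

lemma s9_iter {φ ψ : ℝ → ℝ≥0∞} {τ A : ℝ}
    (hR : ∀ t, 0 < t → t ≤ τ → φ t ≤ φ (2 * t) + ENNReal.ofReal A * ψ t) (n : ℕ) :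
    ∀ u, 0 < u → (∀ j < n, 2 ^ j * u ≤ τ) →
      φ u ≤ φ (2 ^ n * u) + ENNReal.ofReal A * ∑ j ∈ Finset.range n, ψ (2 ^ j * u) := by
  induction n with
  | zero => intro u _ _; simp
  | succ n ih =>
    intro u hu h
    have h1 := ih u hu fun j hj => h j (by omega)
    have h2 := hR (2 ^ n * u) (by positivity) (h n (by omega))
    rw [Finset.sum_range_succ]
    calc φ u ≤ _ := h1
      _ ≤ (φ (2 * (2 ^ n * u)) + ENNReal.ofReal A * ψ (2 ^ n * u)) +
          ENNReal.ofReal A * ∑ j ∈ Finset.range n, ψ (2 ^ j * u) := by gcongr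
      _ = _ := by rw [show 2 * (2 ^ n * u) = 2 ^ (n+1) * u by ring]; ring

lemma s9_ex {u T : ℝ} (hu : 0 < u) : ∃ n : ℕ, T ≤ 2 ^ n * u ∧ ∀ j < n, 2 ^ j * u < T := by
  classical
  have hex : ∃ n : ℕ, T ≤ 2 ^ n * u := by
    obtain ⟨n, hn⟩ := pow_unbounded_of_one_lt (T / u) (by norm_num : (1:ℝ) < 2)
    exact ⟨n, by rw [div_lt_iff₀ hu] at hn; exact hn.le⟩
  exact ⟨Nat.find hex, Nat.find_spec hex, fun j hj => not_le.1 (Nat.find_min hex hj)⟩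

lemma s9_B {φ ψ : ℝ → ℝ≥0∞} (hφ : Antitone φ) (hψ : Antitone ψ) {τ A K : ℝ}
    (hA : 0 ≤ A) (hK : 0 ≤ K)
    (hR : ∀ t, 0 < t → t ≤ τ → φ t ≤ φ (2 * t) + ENNReal.ofReal A * ψ t)
    (hS : φ τ ≤ ENNReal.ofReal K * ψ τ) {T : ℝ} (hT : 0 < T) (hTτ : T ≤ τ) :
    φ T ≤ ENNReal.ofReal (K + A * (1 + Real.log (τ / T) / Real.log 2)) * ψ T := by
  obtain ⟨n, hn, hj⟩ := s9_ex (T := τ) hT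
  have hn' : (n : ℝ) ≤ 1 + Real.log (τ / T) / Real.log 2 := by
    have hl2 : 0 < Real.log 2 := Real.log_pos (by norm_num)
    have hlog : 0 ≤ Real.log (τ / T) := Real.log_nonneg (by rw [le_div_iff₀ hT]; linarith)
    rcases n with _ | n
    · simp; positivity
    · have h1 := hj n (by omega)
      have h2 : (2:ℝ) ^ n ≤ τ / T := by rw [le_div_iff₀ hT]; exact h1.le
      have h3 := Real.log_le_log (by positivity) h2
      rw [Real.log_pow] at h3
      have : (n:ℝ) ≤ Real.log (τ / T) / Real.log 2 := by rw [le_div_iff₀ hl2]; exact h3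
      push_cast; linarith
  have h1 := s9_iter hR n T hT fun j h => (hj j h).le
  have h2 : ∑ j ∈ Finset.range n, ψ (2 ^ j * T) ≤ ENNReal.ofReal n * ψ T := by
    calc ∑ j ∈ Finset.range n, ψ (2 ^ j * T) ≤ ∑ j ∈ Finset.range n, ψ T := by
          refine Finset.sum_le_sum fun j _ => hψ ?_
          exact le_mul_of_one_le_left hT.le (one_le_pow₀ (by norm_num))
      _ = _ := by simp
  calc φ T ≤ _ := h1
    _ ≤ ENNReal.ofReal K * ψ T + ENNReal.ofReal A * (ENNReal.ofReal n * ψ T) := by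
        gcongr
        exact (hφ hn).trans (hS.trans (by gcongr; exact hψ hTτ))
    _ = ENNReal.ofReal (K + A * n) * ψ T := by
        rw [ENNReal.ofReal_add hK (by positivity), ENNReal.ofReal_mul hA]; ring
    _ ≤ _ := by gcongr

lemma s9_pointwise {φ ψ : ℝ → ℝ≥0∞} (hφ : Antitone φ) (hψ : Antitone ψ) {τ A K : ℝ}
    (hτ : 0 < τ) (hA : 0 ≤ A) (hK : 0 ≤ K)
    (hR : ∀ t, 0 < t → t ≤ τ → φ t ≤ φ (2 * t) + ENNReal.ofReal A * ψ t)
    (hS : φ τ ≤ ENNReal.ofReal K * ψ τ) {t : ℝ} (ht : 0 < t) (ht1 : t < 1) {u : ℝ} (hu : 0 < u) :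
    φ u ≤ ENNReal.ofReal A * ∑' j : ℕ, (if 2 ^ j * u < min t τ then ψ (2 ^ j * u) else 0) +
      ENNReal.ofReal ((K + A * (1 + (|Real.log τ| + 1) / Real.log 2)) * (1 - Real.log t)) *
        ψ (min t τ) := by
  set T := min t τ with hTd
  have hT : 0 < T := lt_min ht hτ
  have hTτ : T ≤ τ := min_le_right _ _
  have hlt : Real.log t < 0 := Real.log_neg ht ht1
  have hl2 : 0 < Real.log 2 := Real.log_pos (by norm_num)
  have hB : φ T ≤ ENNReal.ofReal ((K + A * (1 + (|Real.log τ| + 1) / Real.log 2)) *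
      (1 - Real.log t)) * ψ T := by
    refine (s9_B hφ hψ hA hK hR hS hT hTτ).trans ?_
    gcongr
    have h1 : Real.log (τ / T) ≤ |Real.log τ| - Real.log t := by
      rcases le_total t τ with h | h
      · rw [hTd, min_eq_left h, Real.log_div hτ.ne' ht.ne']
        linarith [le_abs_self (Real.log τ)]
      · rw [hTd, min_eq_right h, div_self hτ.ne', Real.log_one]
        linarith [abs_nonneg (Real.log τ)]
    have h2 : |Real.log τ| - Real.log t ≤ (|Real.log τ| + 1) * (1 - Real.log t) := by
      nlinarith [abs_nonneg (Real.log τ)]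
    have h3 : Real.log (τ / T) / Real.log 2 ≤ (|Real.log τ| + 1) / Real.log 2 * (1 - Real.log t) := by
      rw [div_mul_eq_mul_div]
      gcongr; linarith
    have h4 : 1 + Real.log (τ / T) / Real.log 2 ≤
        (1 + (|Real.log τ| + 1) / Real.log 2) * (1 - Real.log t) := by linarith
    have h5 := mul_le_mul_of_nonneg_left h4 hA
    have h6 : K ≤ K * (1 - Real.log t) := le_mul_of_one_le_right hK (by linarith)
    calc _ ≤ K * (1 - Real.log t) + A * ((1 + (|Real.log τ| + 1) / Real.log 2) *
        (1 - Real.log t)) := add_le_add h6 h5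
      _ = _ := by ring
  obtain ⟨n, hn, hj⟩ := s9_ex (T := T) hu
  have h1 := s9_iter hR n u hu fun j h => (hj j h).le.trans hTτ
  calc φ u ≤ _ := h1
    _ = ENNReal.ofReal A * ∑ j ∈ Finset.range n, ψ (2 ^ j * u) + φ (2 ^ n * u) := add_comm _ _
    _ ≤ _ := by
      refine add_le_add (mul_le_mul_right ?_ _) ((hφ hn).trans hB)
      refine le_trans (le_of_eq ?_) (ENNReal.sum_le_tsum (Finset.range n))
      refine Finset.sum_congr rfl fun j h => ?_
      rw [if_pos (hj j (Finset.mem_range.1 h))]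

/-- weighted version: sup form -/
lemma s9_pointwise2 {φ ψ : ℝ → ℝ≥0∞} (hφ : Antitone φ) (hψ : Antitone ψ) {τ A K p : ℝ}
    (hτ : 0 < τ) (hA : 0 ≤ A) (hK : 0 ≤ K)
    (hR : ∀ t, 0 < t → t ≤ τ → φ t ≤ φ (2 * t) + ENNReal.ofReal A * ψ t)
    (hS : φ τ ≤ ENNReal.ofReal K * ψ τ) {t : ℝ} (ht : 0 < t) (ht1 : t < 1) {u : ℝ} (hu : 0 < u) :
    ENNReal.ofReal (u ^ (1/p)) * φ u ≤
      ENNReal.ofReal A * (1 - ENNReal.ofReal (2 ^ (-(1/(2*p)))))⁻¹ *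
        (⨆ j : ℕ, ENNReal.ofReal (2 ^ (-(1/(2*p)))) ^ j * (Ioo 0 (min t τ)).indicator
          (fun v => ENNReal.ofReal (v ^ (1/p)) * ψ v) (2 ^ j * u)) +
      ENNReal.ofReal (u ^ (1/p)) * (ENNReal.ofReal
        ((K + A * (1 + (|Real.log τ| + 1) / Real.log 2)) * (1 - Real.log t)) *
        ψ (min t τ)) := by
  set η := ENNReal.ofReal (2 ^ (-(1/(2*p)))) with hη
  set G := (Ioo 0 (min t τ)).indicator (fun v => ENNReal.ofReal (v ^ (1/p)) * ψ v) with hG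
  set W := ⨆ j : ℕ, η ^ j * G (2 ^ j * u) with hW
  refine (mul_le_mul_right (s9_pointwise hφ hψ hτ hA hK hR hS ht ht1 hu) _).trans ?_
  rw [mul_add]
  refine add_le_add ?_ le_rfl
  have hterm : ∀ j : ℕ, ENNReal.ofReal (u ^ (1/p)) *
      (if 2 ^ j * u < min t τ then ψ (2 ^ j * u) else 0) = η ^ j * (η ^ j * G (2 ^ j * u)) := by
    intro j
    have hpos : 0 < 2 ^ j * u := by positivity
    by_cases hc : 2 ^ j * u < min t τ
    · rw [if_pos hc, hG, indicator_of_mem (show 2 ^ j * u ∈ Ioo 0 (min t τ) from ⟨hpos, hc⟩)]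
      rw [← mul_assoc, ← mul_assoc, hη, ← ENNReal.ofReal_pow (by positivity),
        ← ENNReal.ofReal_mul (by positivity), ← ENNReal.ofReal_mul (by positivity)]
      congr 2
      rw [Real.mul_rpow (by positivity) hu.le, ← mul_assoc]
      have : (2 ^ (-(1/(2*p))) : ℝ) ^ j * (2 ^ (-(1/(2*p)))) ^ j * ((2:ℝ) ^ j) ^ (1/p) = 1 := by
        rw [← Real.rpow_natCast, ← Real.rpow_natCast, ← Real.rpow_mul (by norm_num),
          ← Real.rpow_mul (by norm_num), ← Real.rpow_add (by norm_num),
          ← Real.rpow_add (by norm_num)]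
        rw [show -(1/(2*p)) * (j:ℝ) + -(1/(2*p)) * j + j * (1/p) = 0 by
          rw [show 1/(2*p) = 1/p/2 by rw [div_div, mul_comm]]; ring]
        simp
      rw [this, one_mul]
    · rw [if_neg hc, hG, indicator_of_notMem (fun h => hc h.2)]; simp
  calc ENNReal.ofReal (u ^ (1/p)) * (ENNReal.ofReal A *
        ∑' j : ℕ, (if 2 ^ j * u < min t τ then ψ (2 ^ j * u) else 0))
      = ENNReal.ofReal A * ∑' j : ℕ, ENNReal.ofReal (u ^ (1/p)) *
        (if 2 ^ j * u < min t τ then ψ (2 ^ j * u) else 0) := by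
          rw [ENNReal.tsum_mul_left]; ring
    _ = ENNReal.ofReal A * ∑' j : ℕ, η ^ j * (η ^ j * G (2 ^ j * u)) := by simp_rw [hterm]
    _ ≤ ENNReal.ofReal A * ∑' j : ℕ, η ^ j * W := by
        gcongr with j
        exact le_iSup (fun j : ℕ => η ^ j * G (2 ^ j * u)) j
    _ = _ := by rw [ENNReal.tsum_mul_right, ENNReal.tsum_geometric]; ring

lemma s9_s_bound {t lam p : ℝ} (ht : 0 < t) (ht1 : t < 1) (hp : 1 < p) (hlam : 1 ≤ lam) :
    0 < t * (1 - Real.log t) ^ (-(lam * p)) ∧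
    (t * (1 - Real.log t) ^ (-(lam * p))) ^ (1/p) * (1 - Real.log t) ≤ t ^ (1/p) := by
  have hlt : Real.log t < 0 := Real.log_neg ht ht1
  have hL : 1 < 1 - Real.log t := by linarith
  have hL0 : 0 < 1 - Real.log t := by linarith
  refine ⟨by positivity, ?_⟩
  rw [Real.mul_rpow ht.le (by positivity), ← Real.rpow_mul hL0.le, mul_assoc]
  refine mul_le_of_le_one_right (by positivity) ?_
  have e : -(lam * p) * (1/p) = -lam := by field_simp
  rw [e]
  nth_rewrite 2 [← Real.rpow_one (1 - Real.log t)]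
  rw [← Real.rpow_add hL0]
  exact Real.rpow_le_one_of_one_le_of_nonpos hL.le (by linarith)

lemma s9_pow_lint {p ρ b : ℝ} (hp : 0 < p) (hρ : 0 < ρ) (hb : 0 < b) :
    ∫⁻ u in Ioo 0 b, ENNReal.ofReal (u ^ (1/p)) ^ ρ / ENNReal.ofReal u =
      ENNReal.ofReal (b ^ (ρ/p) / (ρ/p)) := by
  have hq : 0 < ρ / p := by positivity
  have h1 : ∫⁻ u in Ioo 0 b, ENNReal.ofReal (u ^ (1/p)) ^ ρ / ENNReal.ofReal u =
      ∫⁻ u in Ioo 0 b, ENNReal.ofReal (u ^ (ρ/p - 1)) := by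
    refine setLIntegral_congr_fun measurableSet_Ioo fun u hu => ?_
    have hu0 : 0 < u := hu.1
    rw [ENNReal.ofReal_rpow_of_pos (by positivity), ← ENNReal.ofReal_div_of_pos hu0,
      ← Real.rpow_mul hu0.le, Real.rpow_sub_one hu0.ne']
    congr 3; ring
  have hInt0 : IntervalIntegrable (fun u : ℝ => u ^ (ρ/p - 1)) volume 0 b :=
    intervalIntegral.intervalIntegrable_rpow' (by linarith)
  have h2 := integral_rpow (a := 0) (b := b) (r := ρ/p - 1) (Or.inl (by linarith))
  rw [intervalIntegral.integral_of_le hb.le, integral_Ioc_eq_integral_Ioo, sub_add_cancel,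
    Real.zero_rpow hq.ne', sub_zero] at h2
  rw [h1, ← h2, ofReal_integral_eq_lintegral_ofReal]
  · rw [intervalIntegrable_iff_integrableOn_Ioo_of_le hb.le] at hInt0; exact hInt0
  · refine (ae_restrict_mem measurableSet_Ioo).mono fun u hu => ?_
    exact Real.rpow_nonneg hu.1.le _

lemma s9_dilate {F : ℝ → ℝ≥0∞} (c : ℝ) (hc : 0 < c) :
    ∫⁻ u in Ioi 0, F (c * u) / ENNReal.ofReal u = ∫⁻ u in Ioi 0, F u / ENNReal.ofReal u := by
  rw [← lintegral_indicator measurableSet_Ioi, ← lintegral_indicator measurableSet_Ioi]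
  set k : ℝ → ℝ≥0∞ := (Ioi 0).indicator (fun u => F u / ENNReal.ofReal u) with hk
  have h1 : ∀ u, (Ioi 0).indicator (fun u => F (c * u) / ENNReal.ofReal u) u =
      ENNReal.ofReal c * k (c * u) := by
    intro u
    by_cases hu : 0 < u
    · have hcu : 0 < c * u := by positivity
      rw [hk, indicator_of_mem (show u ∈ Ioi 0 from hu),
        indicator_of_mem (show c * u ∈ Ioi 0 from hcu), ENNReal.ofReal_mul hc.le]
      have hc0 : ENNReal.ofReal c ≠ 0 := by simpa using hc
      rw [← mul_div_assoc, ENNReal.mul_div_mul_left _ _ hc0 (by simp)]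
    · have hcu : ¬ 0 < c * u := by
        intro h; exact hu (pos_of_mul_pos_right h hc.le)
      rw [hk, indicator_of_notMem (show u ∉ Ioi 0 from hu),
        indicator_of_notMem (show c * u ∉ Ioi 0 from hcu), mul_zero]
  simp_rw [h1]
  have h2 : ∫⁻ u, k (c * u) = ∫⁻ u, k u ∂(Measure.map (fun u => c * u) volume) := by
    have := lintegral_map_equiv k (Homeomorph.mulLeft₀ c hc.ne').toMeasurableEquiv (μ := volume)
    exact this.symm
  rw [lintegral_const_mul' _ _ (by simp), h2, ← smul_eq_mul, ← lintegral_smul_measure]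
  have h3 := Real.smul_map_volume_mul_left hc.ne'
  rw [abs_of_pos hc] at h3
  rw [h3]

lemma s9_eta_lt {p : ℝ} (hp : 1 < p) : ENNReal.ofReal (2 ^ (-(1/(2*p)))) < 1 := by
  rw [← ENNReal.ofReal_one, ENNReal.ofReal_lt_ofReal_iff (by norm_num)]
  apply Real.rpow_lt_one_of_one_lt_of_neg (by norm_num)
  have : 0 < 1/(2*p) := by positivity
  linarith

lemma s9_T_bound {t τ p : ℝ} (ht : 0 < t) (ht1 : t < 1) (hτ : 0 < τ) (hp : 1 < p) :
    t ^ (1/p) ≤ (2 / min 1 τ) ^ (1/p) * (min t τ / 2) ^ (1/p) := by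
  have hm : 0 < min 1 τ := lt_min one_pos hτ
  have hT : 0 < min t τ := lt_min ht hτ
  rw [← Real.mul_rpow (by positivity) (by positivity)]
  refine Real.rpow_le_rpow ht.le ?_ (by positivity)
  have : t * min 1 τ ≤ min t τ := by
    refine le_min ?_ ?_
    · exact mul_le_of_le_one_right ht.le (min_le_left _ _)
    · exact (mul_le_of_le_one_left hm.le ht1.le).trans (min_le_right _ _)
  rw [div_mul_div_comm, le_div_iff₀ (by positivity)]
  nlinarith

lemma s9_abs_top {φ ψ : ℝ → ℝ≥0∞} (hφ : Antitone φ) (hψ : Antitone ψ) {τ A K p lam : ℝ}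
    (hp : 1 < p) (hlam : 1 ≤ lam)
    (hτ : 0 < τ) (hA : 0 ≤ A) (hK : 0 ≤ K)
    (hR : ∀ t, 0 < t → t ≤ τ → φ t ≤ φ (2 * t) + ENNReal.ofReal A * ψ t)
    (hS : φ τ ≤ ENNReal.ofReal K * ψ τ) {t : ℝ} (ht : 0 < t) (ht1 : t < 1) :
    (⨆ u ∈ Ioo 0 (t * (1 - Real.log t) ^ (-(lam * p))), ENNReal.ofReal (u ^ (1/p)) * φ u) ≤
      (ENNReal.ofReal A * (1 - ENNReal.ofReal (2 ^ (-(1/(2*p)))))⁻¹ +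
        ENNReal.ofReal ((K + A * (1 + (|Real.log τ| + 1) / Real.log 2)) *
          (2 / min 1 τ) ^ (1/p))) *
      ⨆ u ∈ Ioo 0 t, ENNReal.ofReal (u ^ (1/p)) * ψ u := by
  set N := ⨆ u ∈ Ioo 0 t, ENNReal.ofReal (u ^ (1/p)) * ψ u with hN
  obtain ⟨hs0, hs⟩ := s9_s_bound ht ht1 hp hlam
  set s := t * (1 - Real.log t) ^ (-(lam * p))
  set C := K + A * (1 + (|Real.log τ| + 1) / Real.log 2) with hC
  have hl2 : 0 < Real.log 2 := Real.log_pos (by norm_num)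
  have hC0 : 0 ≤ C := by positivity
  have hm : 0 < min 1 τ := lt_min one_pos hτ
  have hT : 0 < min t τ := lt_min ht hτ
  have hlt : Real.log t < 0 := Real.log_neg ht ht1
  refine iSup₂_le fun u hu => ?_
  refine (s9_pointwise2 hφ hψ hτ hA hK hR hS ht ht1 hu.1).trans ?_
  refine le_of_le_of_eq (b := ENNReal.ofReal A * (1 - ENNReal.ofReal (2 ^ (-(1/(2*p)))))⁻¹ * N + ENNReal.ofReal (C * (2 / min 1 τ) ^ (1/p)) * N) ?_ (add_mul _ _ _).symm
  refine add_le_add ?_ ?_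
  · refine mul_le_mul_right ?_ _
    refine iSup_le fun j => ?_
    have : (Ioo 0 (min t τ)).indicator (fun v => ENNReal.ofReal (v ^ (1/p)) * ψ v) (2 ^ j * u)
        ≤ N := by
      by_cases h : 2 ^ j * u ∈ Ioo 0 (min t τ)
      · rw [indicator_of_mem h]
        exact le_iSup₂_of_le (2 ^ j * u) ⟨h.1, h.2.trans_le (min_le_left _ _)⟩ le_rfl
      · rw [indicator_of_notMem h]; exact zero_le
    calc _ ≤ 1 * N := mul_le_mul' (pow_le_one₀ zero_le (s9_eta_lt hp).le) this
      _ = N := one_mul _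
  · have h1 : ENNReal.ofReal ((min t τ / 2) ^ (1/p)) * ψ (min t τ) ≤ N := by
      refine le_trans (mul_le_mul_right (hψ (by linarith : min t τ / 2 ≤ min t τ)) _) ?_
      exact le_iSup₂_of_le (min t τ / 2) ⟨by positivity, by linarith [min_le_left t τ]⟩ le_rfl
    refine le_trans ?_ (mul_le_mul_right h1 _)
    rw [← mul_assoc, ← mul_assoc, ← ENNReal.ofReal_mul (by have := hu.1; positivity),
      ← ENNReal.ofReal_mul (by positivity)]
    refine mul_le_mul' (ENNReal.ofReal_le_ofReal ?_) le_rfl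
    have h2 : u ^ (1/p) * (1 - Real.log t) ≤ t ^ (1/p) := by
      refine le_trans ?_ hs
      have : 0 ≤ 1 - Real.log t := by linarith
      have h3 := hu.1.le
      have h4 := hu.2.le
      gcongr
    calc u ^ (1/p) * (C * (1 - Real.log t)) = C * (u ^ (1/p) * (1 - Real.log t)) := by ring
      _ ≤ C * ((2 / min 1 τ) ^ (1/p) * (min t τ / 2) ^ (1/p)) := by
        exact mul_le_mul_of_nonneg_left (h2.trans (s9_T_bound ht ht1 hτ hp)) hC0
      _ = _ := by ring

lemma s9_add_rpow_le (x y : ℝ≥0∞) {ρ : ℝ} (hρ : 0 < ρ) :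
    (x + y) ^ ρ ≤ 2 ^ ρ * (x ^ ρ + y ^ ρ) := by
  wlog h : x ≤ y generalizing x y
  · rw [add_comm x, add_comm (x ^ ρ)]; exact this y x (le_of_not_ge h)
  calc (x + y) ^ ρ ≤ (2 * y) ^ ρ := by rw [two_mul]; gcongr
    _ = 2 ^ ρ * y ^ ρ := ENNReal.mul_rpow_of_nonneg _ _ hρ.le
    _ ≤ _ := by gcongr; exact le_add_self

lemma s9_iSup_rpow_le (x : ℕ → ℝ≥0∞) {ρ : ℝ} (hρ : 0 < ρ) :
    (⨆ j, x j) ^ ρ ≤ ∑' j, x j ^ ρ := by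
  have : (⨆ j, x j) ≤ (∑' j, x j ^ ρ) ^ (1/ρ) := by
    refine iSup_le fun j => ?_
    calc x j = (x j ^ ρ) ^ (1/ρ) := by
          rw [← ENNReal.rpow_mul, mul_one_div_cancel hρ.ne', ENNReal.rpow_one]
      _ ≤ _ := by gcongr; exact ENNReal.le_tsum j
  calc _ ≤ ((∑' j, x j ^ ρ) ^ (1/ρ)) ^ ρ := by gcongr
    _ = _ := by rw [← ENNReal.rpow_mul, one_div_mul_cancel hρ.ne', ENNReal.rpow_one]

lemma s9_abs_fin {φ ψ : ℝ → ℝ≥0∞} (hφ : Antitone φ) (hψ : Antitone ψ) {τ A K p lam ρ : ℝ}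
    (hp : 1 < p) (hlam : 1 ≤ lam) (hρ : 0 < ρ)
    (hτ : 0 < τ) (hA : 0 ≤ A) (hK : 0 ≤ K)
    (hR : ∀ t, 0 < t → t ≤ τ → φ t ≤ φ (2 * t) + ENNReal.ofReal A * ψ t)
    (hS : φ τ ≤ ENNReal.ofReal K * ψ τ) {t : ℝ} (ht : 0 < t) (ht1 : t < 1) :
    (∫⁻ u in Ioo 0 (t * (1 - Real.log t) ^ (-(lam * p))),
        (ENNReal.ofReal (u ^ (1/p)) * φ u) ^ ρ / ENNReal.ofReal u) ≤
      (2 ^ ρ * ((ENNReal.ofReal A * (1 - ENNReal.ofReal (2 ^ (-(1/(2*p)))))⁻¹) ^ ρ *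
        (1 - ENNReal.ofReal (2 ^ (-(1/(2*p)))) ^ ρ)⁻¹ +
        ENNReal.ofReal (((K + A * (1 + (|Real.log τ| + 1) / Real.log 2)) *
          (2 / min 1 τ) ^ (1/p)) ^ ρ))) *
      ∫⁻ u in Ioo 0 t, (ENNReal.ofReal (u ^ (1/p)) * ψ u) ^ ρ / ENNReal.ofReal u := by
  set N := ∫⁻ u in Ioo 0 t, (ENNReal.ofReal (u ^ (1/p)) * ψ u) ^ ρ / ENNReal.ofReal u with hN
  obtain ⟨hs0, hs⟩ := s9_s_bound ht ht1 hp hlam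
  set s := t * (1 - Real.log t) ^ (-(lam * p))
  set C := K + A * (1 + (|Real.log τ| + 1) / Real.log 2) with hC
  set η := ENNReal.ofReal (2 ^ (-(1/(2*p)))) with hη
  set G := (Ioo 0 (min t τ)).indicator (fun v => ENNReal.ofReal (v ^ (1/p)) * ψ v) with hG
  have hl2 : 0 < Real.log 2 := Real.log_pos (by norm_num)
  have hC0 : 0 ≤ C := by positivity
  have hm : 0 < min 1 τ := lt_min one_pos hτ
  have hT : 0 < min t τ := lt_min ht hτ
  have hlt : Real.log t < 0 := Real.log_neg ht ht1
  have hL0 : 0 < 1 - Real.log t := by linarith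
  have hp0 : 0 < p := by linarith
  have hGm : Measurable G := by
    refine Measurable.indicator ?_ measurableSet_Ioo
    exact (ENNReal.measurable_ofReal.comp (by fun_prop)).mul hψ.measurable
  set B := ENNReal.ofReal A * (1 - η)⁻¹ with hB
  set c := ENNReal.ofReal (C * (1 - Real.log t)) * ψ (min t τ) with hc
  -- integral of first part
  have hI1 : ∫⁻ u in Ioo 0 s, (∑' j : ℕ, (η ^ j * G (2 ^ j * u)) ^ ρ) / ENNReal.ofReal u ≤
      (1 - η ^ ρ)⁻¹ * N := by
    have h0 : ∀ u : ℝ, (∑' j : ℕ, (η ^ j * G (2 ^ j * u)) ^ ρ) / ENNReal.ofReal u =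
        ∑' j : ℕ, (η ^ ρ) ^ j * (G (2 ^ j * u) ^ ρ / ENNReal.ofReal u) := by
      intro u
      rw [ENNReal.div_eq_inv_mul, ← ENNReal.tsum_mul_left]
      refine tsum_congr fun j => ?_
      rw [ENNReal.mul_rpow_of_nonneg _ _ hρ.le, ← ENNReal.rpow_natCast, ← ENNReal.rpow_natCast,
        ← ENNReal.rpow_mul, ← ENNReal.rpow_mul, mul_comm (j:ℝ), ENNReal.div_eq_inv_mul]
      ring
    simp_rw [h0]
    rw [lintegral_tsum (fun j => by
      refine Measurable.aemeasurable ?_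
      refine Measurable.const_mul (Measurable.div ?_ ENNReal.measurable_ofReal) _
      exact (hGm.comp (measurable_const_mul _)).pow_const ρ)]
    rw [← ENNReal.tsum_geometric, ← ENNReal.tsum_mul_right]
    refine ENNReal.tsum_le_tsum fun j => ?_
    rw [lintegral_const_mul' _ _ (ENNReal.pow_ne_top (ENNReal.rpow_ne_top_of_nonneg hρ.le
      (by simp [hη])))]
    refine mul_le_mul_right ?_ _
    calc ∫⁻ u in Ioo 0 s, G (2 ^ j * u) ^ ρ / ENNReal.ofReal u
        ≤ ∫⁻ u in Ioi 0, G (2 ^ j * u) ^ ρ / ENNReal.ofReal u :=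
          lintegral_mono_set Ioo_subset_Ioi_self
      _ = ∫⁻ u in Ioi 0, G u ^ ρ / ENNReal.ofReal u :=
          s9_dilate (F := fun v => G v ^ ρ) (2 ^ j) (by positivity)
      _ ≤ N := by
          rw [hN, ← lintegral_indicator measurableSet_Ioi, ← lintegral_indicator measurableSet_Ioo]
          refine lintegral_mono fun u => ?_
          by_cases hu : u ∈ Ioo 0 (min t τ)
          · have h1 : u ∈ Ioo 0 t := ⟨hu.1, hu.2.trans_le (min_le_left _ _)⟩
            rw [indicator_of_mem (show u ∈ Ioi 0 from hu.1), indicator_of_mem h1, hG,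
              indicator_of_mem hu]
          · have : (Ioi 0).indicator (fun u => G u ^ ρ / ENNReal.ofReal u) u = 0 := by
              by_cases h2 : u ∈ Ioi (0:ℝ)
              · rw [indicator_of_mem h2, hG, indicator_of_notMem hu, ENNReal.zero_rpow_of_pos hρ,
                  ENNReal.zero_div]
              · rw [indicator_of_notMem h2]
            rw [this]; exact zero_le
  have hI2 : ∫⁻ u in Ioo 0 s, (ENNReal.ofReal (u ^ (1/p)) * c) ^ ρ / ENNReal.ofReal u ≤
      ENNReal.ofReal ((C * (2 / min 1 τ) ^ (1/p)) ^ ρ) * N := by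
    have hmeas : Measurable fun u : ℝ => ENNReal.ofReal (u ^ (1/p)) ^ ρ / ENNReal.ofReal u := by
      have h1 : Measurable fun u : ℝ => ENNReal.ofReal (u ^ (1/p)) := by fun_prop
      exact (h1.pow_const ρ).div ENNReal.measurable_ofReal
    have hN1 : ψ (min t τ) ^ ρ * ENNReal.ofReal ((min t τ) ^ (ρ/p) / (ρ/p)) ≤ N := by
      rw [← s9_pow_lint hp0 hρ hT, ← lintegral_const_mul _ hmeas]
      refine le_trans ?_ (lintegral_mono_set (Ioo_subset_Ioo_right (min_le_left t τ)))
      refine setLIntegral_mono' measurableSet_Ioo fun u hu => ?_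
      rw [ENNReal.mul_rpow_of_nonneg _ _ hρ.le, mul_comm (ENNReal.ofReal (u ^ (1/p)) ^ ρ),
        mul_div_assoc]
      gcongr
      exact hψ hu.2.le
    have e1 : ∀ u : ℝ, (ENNReal.ofReal (u ^ (1/p)) * c) ^ ρ / ENNReal.ofReal u =
        c ^ ρ * (ENNReal.ofReal (u ^ (1/p)) ^ ρ / ENNReal.ofReal u) := by
      intro u
      rw [ENNReal.mul_rpow_of_nonneg _ _ hρ.le, mul_comm (ENNReal.ofReal (u ^ (1/p)) ^ ρ),
        mul_div_assoc]
    simp_rw [e1]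
    rw [lintegral_const_mul _ hmeas, s9_pow_lint hp0 hρ hs0]
    refine le_trans ?_ (mul_le_mul_right hN1 _)
    rw [hc, ENNReal.mul_rpow_of_nonneg _ _ hρ.le, ENNReal.ofReal_rpow_of_nonneg (by positivity) hρ.le]
    have hreal : (C * (1 - Real.log t)) ^ ρ * (s ^ (ρ/p) / (ρ/p)) ≤
        (C * (2 / min 1 τ) ^ (1/p)) ^ ρ * ((min t τ) ^ (ρ/p) / (ρ/p)) := by
      have e2 : ∀ x : ℝ, 0 < x → x ^ (ρ/p) = (x ^ (1/p)) ^ ρ := by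
        intro x hx
        rw [← Real.rpow_mul hx.le]; congr 1; ring
      rw [e2 s hs0, e2 _ hT, ← mul_div_assoc, ← mul_div_assoc,
        ← Real.mul_rpow (by positivity) (by positivity),
        ← Real.mul_rpow (by positivity) (by positivity)]
      refine div_le_div_of_nonneg_right ?_ (by positivity)
      refine Real.rpow_le_rpow (by positivity) ?_ hρ.le
      have h5 : (min t τ / 2) ^ (1/p) ≤ (min t τ) ^ (1/p) :=
        Real.rpow_le_rpow (by positivity) (by linarith) (by positivity)
      calc C * (1 - Real.log t) * s ^ (1/p) = C * (s ^ (1/p) * (1 - Real.log t)) := by ring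
        _ ≤ C * ((2 / min 1 τ) ^ (1/p) * (min t τ / 2) ^ (1/p)) := by
          exact mul_le_mul_of_nonneg_left (hs.trans (s9_T_bound ht ht1 hτ hp)) hC0
        _ ≤ C * ((2 / min 1 τ) ^ (1/p) * (min t τ) ^ (1/p)) := by gcongr
        _ = _ := by ring
    calc _ = ψ (min t τ) ^ ρ * ENNReal.ofReal ((C * (1 - Real.log t)) ^ ρ * (s ^ (ρ/p) / (ρ/p))) := by
          rw [ENNReal.ofReal_mul (by positivity)]; ring
      _ ≤ ψ (min t τ) ^ ρ * ENNReal.ofReal ((C * (2 / min 1 τ) ^ (1/p)) ^ ρ *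
          ((min t τ) ^ (ρ/p) / (ρ/p))) := by gcongr
      _ = _ := by rw [ENNReal.ofReal_mul (by positivity)]; ring
  -- combine
  have hpt : ∀ u ∈ Ioo 0 s, (ENNReal.ofReal (u ^ (1/p)) * φ u) ^ ρ / ENNReal.ofReal u ≤
      (2 ^ ρ * B ^ ρ) * ((∑' j : ℕ, (η ^ j * G (2 ^ j * u)) ^ ρ) / ENNReal.ofReal u) +
      2 ^ ρ * ((ENNReal.ofReal (u ^ (1/p)) * c) ^ ρ / ENNReal.ofReal u) := by
    intro u hu
    have h1 := s9_pointwise2 (p := p) hφ hψ hτ hA hK hR hS ht ht1 hu.1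
    calc (ENNReal.ofReal (u ^ (1/p)) * φ u) ^ ρ / ENNReal.ofReal u ≤
        (B * (⨆ j : ℕ, η ^ j * G (2 ^ j * u)) + ENNReal.ofReal (u ^ (1/p)) * c) ^ ρ /
          ENNReal.ofReal u := by gcongr
      _ ≤ (2 ^ ρ * (B ^ ρ * (∑' j : ℕ, (η ^ j * G (2 ^ j * u)) ^ ρ) +
          (ENNReal.ofReal (u ^ (1/p)) * c) ^ ρ)) / ENNReal.ofReal u := by
        gcongr
        refine (s9_add_rpow_le _ _ hρ).trans ?_
        rw [ENNReal.mul_rpow_of_nonneg B _ hρ.le]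
        gcongr
        exact s9_iSup_rpow_le _ hρ
      _ = _ := by simp only [ENNReal.div_eq_inv_mul]; ring
  have hm2 : Measurable fun u : ℝ => 2 ^ ρ * ((ENNReal.ofReal (u ^ (1/p)) * c) ^ ρ / ENNReal.ofReal u) := by
    refine Measurable.const_mul (Measurable.div (Measurable.pow_const (Measurable.mul_const ?_ _) _)
      ENNReal.measurable_ofReal) _
    exact ENNReal.measurable_ofReal.comp (by fun_prop)
  have hBt : B ≠ ∞ := by
    refine ENNReal.mul_ne_top (by simp) (ENNReal.inv_ne_top.2 ?_)
    exact (tsub_pos_of_lt (s9_eta_lt hp)).ne'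
  calc _ ≤ ∫⁻ u in Ioo 0 s, ((2 ^ ρ * B ^ ρ) * ((∑' j : ℕ, (η ^ j * G (2 ^ j * u)) ^ ρ) / ENNReal.ofReal u) +
      2 ^ ρ * ((ENNReal.ofReal (u ^ (1/p)) * c) ^ ρ / ENNReal.ofReal u)) :=
        setLIntegral_mono' measurableSet_Ioo hpt
    _ = (2 ^ ρ * B ^ ρ) * (∫⁻ u in Ioo 0 s, (∑' j : ℕ, (η ^ j * G (2 ^ j * u)) ^ ρ) / ENNReal.ofReal u) +
      2 ^ ρ * ∫⁻ u in Ioo 0 s, (ENNReal.ofReal (u ^ (1/p)) * c) ^ ρ / ENNReal.ofReal u := by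
        rw [lintegral_add_right _ hm2, lintegral_const_mul', lintegral_const_mul']
        · exact ENNReal.rpow_ne_top_of_nonneg hρ.le (by simp)
        · exact ENNReal.mul_ne_top (ENNReal.rpow_ne_top_of_nonneg hρ.le (by simp))
            (ENNReal.rpow_ne_top_of_nonneg hρ.le hBt)
    _ ≤ (2 ^ ρ * B ^ ρ) * ((1 - η ^ ρ)⁻¹ * N) +
      2 ^ ρ * (ENNReal.ofReal ((C * (2 / min 1 τ) ^ (1/p)) ^ ρ) * N) := by gcongr
    _ = _ := by ring

lemma s9_abs {τ A K p lam : ℝ} {r : ℝ≥0∞} (hp : 1 < p) (hlam : 1 ≤ lam) (hr : 0 < r)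
    (hτ : 0 < τ) (hA : 0 ≤ A) (hK : 0 ≤ K) :
    ∃ C : ℝ, 0 < C ∧ ∀ φ ψ : ℝ → ℝ≥0∞, Antitone φ → Antitone ψ →
      (∀ t, 0 < t → t ≤ τ → φ t ≤ φ (2 * t) + ENNReal.ofReal A * ψ t) →
      (φ τ ≤ ENNReal.ofReal K * ψ τ) → ∀ t ∈ Ioo (0:ℝ) 1,
      qint r (Ioo 0 (t * (1 - Real.log t) ^ (-(lam * p))))
        (fun u => ENNReal.ofReal (u ^ (1/p)) * φ u) ≤
      ENNReal.ofReal C * qint r (Ioo 0 t) (fun u => ENNReal.ofReal (u ^ (1/p)) * ψ u) := by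
  have main : ∃ M : ℝ≥0∞, M ≠ ∞ ∧ ∀ φ ψ : ℝ → ℝ≥0∞, Antitone φ → Antitone ψ →
      (∀ t, 0 < t → t ≤ τ → φ t ≤ φ (2 * t) + ENNReal.ofReal A * ψ t) →
      (φ τ ≤ ENNReal.ofReal K * ψ τ) → ∀ t ∈ Ioo (0:ℝ) 1,
      qint r (Ioo 0 (t * (1 - Real.log t) ^ (-(lam * p))))
        (fun u => ENNReal.ofReal (u ^ (1/p)) * φ u) ≤
      M * qint r (Ioo 0 t) (fun u => ENNReal.ofReal (u ^ (1/p)) * ψ u) := by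
    have hη := s9_eta_lt hp
    have hi1 : (1 - ENNReal.ofReal (2 ^ (-(1/(2*p)))))⁻¹ ≠ ∞ :=
      ENNReal.inv_ne_top.2 (tsub_pos_of_lt hη).ne'
    rcases eq_or_ne r ∞ with rfl | hrt
    · refine ⟨(ENNReal.ofReal A * (1 - ENNReal.ofReal (2 ^ (-(1/(2*p)))))⁻¹ +
        ENNReal.ofReal ((K + A * (1 + (|Real.log τ| + 1) / Real.log 2)) *
          (2 / min 1 τ) ^ (1/p))), ?_, fun φ ψ hφ hψ hR hS t ht => ?_⟩
      rotate_left
      · simp only [qint, if_true]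
        exact s9_abs_top hφ hψ hp hlam hτ hA hK hR hS ht.1 ht.2
      · exact ENNReal.add_ne_top.2 ⟨ENNReal.mul_ne_top (by simp) hi1, by simp⟩
    · have hρ : 0 < r.toReal := ENNReal.toReal_pos hr.ne' hrt
      refine ⟨(2 ^ r.toReal * ((ENNReal.ofReal A * (1 - ENNReal.ofReal (2 ^ (-(1/(2*p)))))⁻¹) ^ r.toReal *
        (1 - ENNReal.ofReal (2 ^ (-(1/(2*p)))) ^ r.toReal)⁻¹ +
        ENNReal.ofReal (((K + A * (1 + (|Real.log τ| + 1) / Real.log 2)) *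
          (2 / min 1 τ) ^ (1/p)) ^ r.toReal))), ?_, fun φ ψ hφ hψ hR hS t ht => ?_⟩
      rotate_left
      · simp only [qint, if_neg hrt]
        exact s9_abs_fin hφ hψ hp hlam hρ hτ hA hK hR hS ht.1 ht.2
      · refine ENNReal.mul_ne_top (ENNReal.rpow_ne_top_of_nonneg hρ.le (by simp))
          (ENNReal.add_ne_top.2 ⟨ENNReal.mul_ne_top (ENNReal.rpow_ne_top_of_nonneg hρ.le
            (ENNReal.mul_ne_top (by simp) hi1)) ?_, by simp⟩)
        exact ENNReal.inv_ne_top.2 (tsub_pos_of_lt (ENNReal.rpow_lt_one hη hρ)).ne'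
  obtain ⟨M, hM, h⟩ := main
  refine ⟨M.toReal + 1, by positivity, fun φ ψ hφ hψ hR hS t ht => ?_⟩
  refine (h φ ψ hφ hψ hR hS t ht).trans ?_
  gcongr
  rw [← ENNReal.ofReal_toReal hM]
  apply ENNReal.ofReal_le_ofReal
  rw [ENNReal.toReal_ofReal (by positivity)]
  linarith

lemma s9_tau_lt {d : ℕ} {l : ℝ} (hl : 0 < l) : l ^ d / (3 * 2 ^ (d+1)) < l ^ d := by
  have h : (1:ℝ) ≤ 2 ^ (d+1) := one_le_pow₀ (by norm_num)
  have := pow_pos hl d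
  rw [div_lt_iff₀ (by positivity)]
  nlinarith

lemma s9_iii_ii {d : ℕ} (hd : 0 < d) {a : Fin d → ℝ} {l : ℝ} (hl : 0 < l) {lam : ℝ}
    (hlam : 1 ≤ lam) {p : ℝ} (hp : 1 < p) {r : ℝ≥0∞} (hr : 0 < r) :
    ∃ C : ℝ, 0 < C ∧ ∀ f : Euc d → ℝ, Measurable f → IntegrableOn f (cubeSet a l) volume →
          lorentz (volume.restrict (cubeSet a l)) f p r (Set.Ioo 0 1) ≠ ∞ →
          ∀ t ∈ Set.Ioo (0 : ℝ) 1,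
            qint r (Set.Ioo 0 (t * (1 - Real.log t) ^ (-(lam * p))))
                (fun u => ENNReal.ofReal (u ^ (1 / p)) *
                  rearrR (volume.restrict (cubeSet a l)) (fun x => f x - ⨍ z in (cubeSet a l), f z) u) ≤
              ENNReal.ofReal C *
                qint r (Set.Ioo 0 t)
                  (fun u => ENNReal.ofReal (u ^ (1 / p)) *
                    rearr (volume.restrict (cubeSet a l)) (sharpLocal volume (cubeSet a l) f) u) := by
  have hτ : 0 < l ^ d / (3 * 2 ^ (d+1)) := by positivity
  obtain ⟨C, hC, h⟩ := s9_abs (τ := l ^ d / (3 * 2 ^ (d+1))) (A := 3 + 3 * 2 ^ (d+1))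
    (K := l ^ d / (l ^ d / (3 * 2 ^ (d+1)))) hp hlam hr hτ (by positivity) (by positivity)
  refine ⟨C, hC, fun f hf hfi _ t ht => ?_⟩
  refine h _ _ (s9_rearr_antitone _ _) (s9_rearr_antitone _ _) (fun u hu hu1 => ?_) ?_ t ht
  · exact s9_R hd hl hf hfi _ hu hu1
  · exact s9_S hl hf hfi hτ (s9_tau_lt hl)

lemma s9_rearr_le_bmo {d : ℕ} {a : Fin d → ℝ} {l : ℝ} {f : Euc d → ℝ} {B : ℝ≥0∞}
    (hB : bmoQ (cubeSet a l) f ≤ B) (t : ℝ) :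
    rearr (volume.restrict (cubeSet a l)) (sharpLocal volume (cubeSet a l) f) t ≤ B := by
  refine s9_rearr_le ?_
  rw [Measure.restrict_apply' (s9_measurableSet_cubeSet a l)]
  have : {x | B < sharpLocal volume (cubeSet a l) f x} ∩ cubeSet a l = ∅ := by
    rw [eq_empty_iff_forall_notMem]
    rintro x ⟨h1, h2⟩
    exact absurd (lt_of_lt_of_le h1 ((le_iSup₂_of_le x h2 le_rfl).trans hB)) (lt_irrefl _)
  rw [this]; simp

/-- exponential decay along dyadic sequence -/
lemma s9_jn_dyadic {d : ℕ} (hd : 0 < d) {a : Fin d → ℝ} {l : ℝ} (hl : 0 < l)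
    {f : Euc d → ℝ} (hf : Measurable f) (hfi : IntegrableOn f (cubeSet a l))
    {B : ℝ} (hB0 : 0 ≤ B) (hB : bmoQ (cubeSet a l) f ≤ ENNReal.ofReal B) (j : ℕ) {ξ : ℝ}
    (hξ : (3 * 2 ^ (d+1) + j * (3 + 3 * 2 ^ (d+1))) * B ≤ ξ) :
    volume {x ∈ cubeSet a l | ξ < |f x - ⨍ z in cubeSet a l, f z|} ≤
      ENNReal.ofReal (l ^ d * (1/2) ^ j) := by
  set τ := l ^ d / (3 * 2 ^ (d+1)) with hτd
  have hτ : 0 < τ := by positivity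
  set A : ℝ := 3 + 3 * 2 ^ (d+1) with hA
  set K : ℝ := 3 * 2 ^ (d+1) with hK
  have hA0 : 0 ≤ A := by positivity
  have hK0 : 0 ≤ K := by positivity
  set φ := rearrR (volume.restrict (cubeSet a l)) (fun x => f x - ⨍ z in cubeSet a l, f z) with hφ
  set ψ := rearr (volume.restrict (cubeSet a l)) (sharpLocal volume (cubeSet a l) f)
  have hψ : ∀ t, ψ t ≤ ENNReal.ofReal B := s9_rearr_le_bmo hB
  have hu : 0 < τ * (1/2) ^ j := by positivity
  have h1 := s9_iter (φ := φ) (ψ := ψ) (τ := τ) (A := A)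
    (fun u hu hu1 => s9_R hd hl hf hfi _ hu hu1) j (τ * (1/2) ^ j) hu (fun i hi => by
      have e : (2:ℝ) ^ i * (τ * (1/2) ^ j) = τ * (2 ^ i / 2 ^ j) := by
        rw [one_div, inv_pow]; ring
      rw [e]
      refine mul_le_of_le_one_right hτ.le ?_
      rw [div_le_one (by positivity)]
      exact pow_le_pow_right₀ (by norm_num) hi.le)
  have e : (2:ℝ) ^ j * (τ * (1/2) ^ j) = τ := by
    rw [one_div, inv_pow]; field_simp
  rw [e] at h1
  have h2 : φ τ ≤ ENNReal.ofReal (K * B) := by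
    have := s9_S hl hf hfi hτ (s9_tau_lt (d := d) hl)
    have e2 : l ^ d / τ = K := by rw [hτd]; field_simp
    rw [e2] at this
    rw [ENNReal.ofReal_mul hK0]
    exact this.trans (mul_le_mul_right (hψ _) _)
  have h3 : φ (τ * (1/2) ^ j) ≤ ENNReal.ofReal ξ := by
    refine h1.trans ?_
    refine le_trans (add_le_add h2 (mul_le_mul_right (Finset.sum_le_sum fun i _ => hψ _) _)) ?_
    rw [Finset.sum_const, Finset.card_range, nsmul_eq_mul, ← ENNReal.ofReal_natCast,
      ← ENNReal.ofReal_mul (by positivity), ← ENNReal.ofReal_mul hA0,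
      ← ENNReal.ofReal_add (by positivity) (by positivity)]
    refine ENNReal.ofReal_le_ofReal ?_
    linarith
  have h4 := s9_meas_rearr (μ := volume.restrict (cubeSet a l))
    (g := fun x => ENNReal.ofReal |f x - ⨍ z in cubeSet a l, f z|) (t := τ * (1/2) ^ j)
  rw [Measure.restrict_apply' (s9_measurableSet_cubeSet a l)] at h4
  have hξ0 : 0 ≤ ξ := le_trans (by positivity) hξ
  refine le_trans (measure_mono ?_) (h4.trans (ENNReal.ofReal_le_ofReal ?_))
  · rintro x ⟨hx1, hx2⟩
    refine ⟨lt_of_le_of_lt h3 ?_, hx1⟩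
    exact (ENNReal.ofReal_lt_ofReal_iff (hξ0.trans_lt hx2)).2 hx2
  · exact mul_le_mul_of_nonneg_right (s9_tau_lt hl).le (by positivity)

lemma s9_iii_i {d : ℕ} (hd : 0 < d) {a : Fin d → ℝ} {l : ℝ} (hl : 0 < l) {lam : ℝ}
    (hlam : 1 ≤ lam) {f : Euc d → ℝ} (hf : Measurable f) (hfi : IntegrableOn f (cubeSet a l))
    (hb : bmoQ (cubeSet a l) f ≠ ∞) :
    ∃ c₁ c₂ : ℝ, 0 < c₁ ∧ 0 < c₂ ∧ ∀ ξ : ℝ, 0 < ξ →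
          volume {x ∈ cubeSet a l | ξ < |f x - ⨍ z in cubeSet a l, f z|} ≤
            ENNReal.ofReal (c₁ *
              Real.exp (-c₂ * (ξ / (bmoQ (cubeSet a l) f).toReal) ^ ((1 : ℝ) / lam))) := by
  set B := (bmoQ (cubeSet a l) f).toReal with hBd
  have hB0 : 0 ≤ B := ENNReal.toReal_nonneg
  have hB : bmoQ (cubeSet a l) f ≤ ENNReal.ofReal B := by rw [hBd, ENNReal.ofReal_toReal hb]
  set A : ℝ := 3 + 3 * 2 ^ (d+1) with hA
  set K : ℝ := 3 * 2 ^ (d+1) with hK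
  have hA0 : 0 < A := by positivity
  have hK0 : 0 < K := by positivity
  have hl2 : 0 < Real.log 2 := Real.log_pos (by norm_num)
  set c₂ := Real.log 2 / A with hc₂
  have hc₂0 : 0 < c₂ := by positivity
  refine ⟨l ^ d * Real.exp (c₂ * (K + 1 + A)), c₂, by positivity, hc₂0, fun ξ hξ => ?_⟩
  set y := ξ / B with hy
  have hy0 : 0 ≤ y := by positivity
  have hy1 : y ^ (1/lam) ≤ 1 + y := by
    rcases le_total y 1 with h | h
    · have := Real.rpow_le_one hy0 h (show 0 ≤ 1/lam by positivity)
      linarith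
    · have := Real.rpow_le_rpow_of_exponent_le h (show 1/lam ≤ 1 by
        rw [div_le_one (by linarith)]; exact hlam)
      rw [Real.rpow_one] at this; linarith
  have key : ∀ j : ℕ, y - K < (j+1) * A → l ^ d * (1/2) ^ j ≤
      l ^ d * Real.exp (c₂ * (K + 1 + A)) * Real.exp (-c₂ * y ^ (1/lam)) := by
    intro j hj
    rw [mul_assoc, ← Real.exp_add]
    refine mul_le_mul_of_nonneg_left ?_ (by positivity)
    have e : ((1:ℝ)/2) ^ j = Real.exp (-(c₂ * A * j)) := by
      rw [hc₂, div_mul_cancel₀ _ hA0.ne', Real.exp_neg, mul_comm, Real.exp_nat_mul,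
        Real.exp_log (by norm_num)]
      rw [one_div, inv_pow]
    rw [e, Real.exp_le_exp]
    have : c₂ * y ^ (1/lam) ≤ c₂ * (1 + (K + (j+1) * A)) :=
      mul_le_mul_of_nonneg_left (by linarith) hc₂0.le
    nlinarith
  by_cases hcase : K * B ≤ ξ ∧ 0 < B
  · obtain ⟨h1, hBp⟩ := hcase
    have hyK : K ≤ y := by rw [hy, le_div_iff₀ hBp]; exact h1
    have hfl := Nat.floor_le (show 0 ≤ (y - K)/A by apply div_nonneg <;> linarith)
    have hfl2 := Nat.lt_floor_add_one ((y-K)/A)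
    rw [div_lt_iff₀ hA0] at hfl2
    rw [le_div_iff₀ hA0] at hfl
    refine (s9_jn_dyadic hd hl hf hfi hB0 hB ⌊(y-K)/A⌋₊ ?_).trans
      (ENNReal.ofReal_le_ofReal (key _ hfl2))
    have : ξ = y * B := by rw [hy]; field_simp
    rw [this]
    exact mul_le_mul_of_nonneg_right (by linarith) hB0
  · have hyK : y < K + A := by
      by_cases hBp : 0 < B
      · have : ξ < K * B := by by_contra h; exact hcase ⟨not_lt.1 h, hBp⟩
        rw [hy, div_lt_iff₀ hBp]; nlinarith
      · have : B = 0 := le_antisymm (not_lt.1 hBp) hB0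
        rw [hy, this, _root_.div_zero]; positivity
    calc _ ≤ volume (cubeSet a l) := measure_mono fun x hx => hx.1
      _ = ENNReal.ofReal (l ^ d * (1/2) ^ 0) := by rw [s9_volume_cubeSet a hl.le]; simp
      _ ≤ _ := ENNReal.ofReal_le_ofReal (key 0 (by push_cast; linarith))

lemma s9_map {d : ℕ} (i0 : Fin d) (b : Fin d → ℝ) {h : ℝ} (hh : 0 ≤ h) :
    Measure.map (fun x : Euc d => x i0) (volume.restrict (cubeSet b h)) =
      ENNReal.ofReal (h ^ (d-1)) • volume.restrict (Icc (b i0) (b i0 + h)) := by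
  have h1 : MeasurePreserving (WithLp.ofLp : Euc d → (Fin d → ℝ)) :=
    PiLp.volume_preserving_ofLp (Fin d)
  have hS : MeasurableSet (univ.pi fun i => Icc (b i) (b i + h)) :=
    MeasurableSet.univ_pi fun i => measurableSet_Icc
  have h2 := (h1.restrict_preimage hS).map_eq
  rw [← s9_cubeSet_eq] at h2
  have h3 : (fun x : Euc d => x i0) = (fun y : Fin d → ℝ => y i0) ∘ WithLp.ofLp := rfl
  rw [h3, ← Measure.map_map (measurable_pi_apply _) h1.measurable, h2, volume_pi,
    Measure.restrict_pi_pi]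
  have h4 := Measure.pi_map_eval (μ := fun i => (volume : Measure ℝ).restrict (Icc (b i) (b i + h))) i0
  change Measure.map (Function.eval i0) _ = _
  rw [h4]
  congr 1
  simp only [Measure.restrict_apply_univ, Real.volume_Icc, add_sub_cancel_left, Finset.prod_const]
  rw [ENNReal.ofReal_pow hh, Finset.card_erase_of_mem (Finset.mem_univ _)]
  simp

lemma s9_logint (α u v : ℝ) (huv : u ≤ v) :
    IntegrableOn (fun y => Real.log (y - α)) (Icc u v) := by
  rw [← intervalIntegrable_iff_integrableOn_Icc_of_le huv]
  have := (intervalIntegral.intervalIntegrable_log' (a := u - α) (b := v - α)).comp_sub_right α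
  simpa using this

lemma s9_f_int {d : ℕ} (i0 : Fin d) (α : ℝ) (b : Fin d → ℝ) {h : ℝ} (hh : 0 ≤ h) :
    IntegrableOn (fun x : Euc d => Real.log (x i0 - α)) (cubeSet b h) := by
  have hm : Measurable fun x : Euc d => x i0 := by fun_prop
  have h1 : Integrable (fun y => Real.log (y - α))
      (Measure.map (fun x : Euc d => x i0) (volume.restrict (cubeSet b h))) := by
    rw [s9_map i0 b hh]
    exact (s9_logint α _ _ (by linarith)).smul_measure (by simp)
  exact h1.comp_measurable hm

lemma s9_log1 {β h : ℝ} (hβ : 0 ≤ β) (hh : 0 < h) :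
    ∫ y in β..(β+h), (Real.log (β+h) - Real.log y) ≤ h := by
  rw [intervalIntegral.integral_sub (by simp) intervalIntegral.intervalIntegrable_log', integral_log]
  simp only [intervalIntegral.integral_const, smul_eq_mul]
  rcases hβ.eq_or_lt with rfl | hβ
  · simp; 
  · have := Real.log_le_log hβ (by linarith : β ≤ β + h)
    nlinarith

lemma s9_f_osc {d : ℕ} (i0 : Fin d) (α : ℝ) (b : Fin d → ℝ) {h : ℝ} (hh : 0 < h)
    (hb : α ≤ b i0) :
    ∫ x in cubeSet b h, |Real.log (x i0 - α) - Real.log (b i0 - α + h)| ≤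
      h ^ d := by
  have hm : Measurable fun x : Euc d => x i0 := by fun_prop
  set M := Real.log (b i0 - α + h)
  have hmg : Measurable fun y : ℝ => |Real.log (y - α) - M| := by
    exact (measurable_norm.comp ((Real.measurable_log.comp (measurable_id.sub_const α)).sub_const M))
  have h1 := integral_map (μ := volume.restrict (cubeSet b h)) hm.aemeasurable
    (f := fun y => |Real.log (y - α) - M|) hmg.aestronglyMeasurable
  rw [s9_map i0 b hh.le, integral_smul_measure] at h1
  rw [← h1, ENNReal.toReal_ofReal (by positivity), smul_eq_mul, integral_Icc_eq_integral_Ioc,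
    ← intervalIntegral.integral_of_le (by linarith)]
  have h2 : ∫ y in (b i0)..(b i0 + h), |Real.log (y - α) - M| =
      ∫ y in (b i0 - α)..(b i0 - α + h), (M - Real.log y) := by
    have e := intervalIntegral.integral_comp_sub_right (a := b i0) (b := b i0 + h)
      (fun y => |Real.log y - M|) α
    rw [e]
    have e3 : b i0 + h - α = b i0 - α + h := by ring
    rw [e3]
    refine intervalIntegral.integral_congr_ae ?_
    refine Eventually.of_forall fun y hy => ?_
    rw [uIoc_of_le (by linarith)] at hy
    rw [abs_of_nonpos]
    · ring
    · have := Real.log_le_log (by linarith [hy.1]) hy.2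
      linarith
  rw [h2]
  calc _ ≤ h ^ (d-1) * h := by
        refine mul_le_mul_of_nonneg_left (s9_log1 (by linarith) hh) (by positivity)
    _ = h ^ d := by
      rw [← pow_succ, Nat.sub_add_cancel]
      exact Nat.succ_le_of_lt (Fin.pos i0)

lemma s9_f_bmo {d : ℕ} (i0 : Fin d) (a : Fin d → ℝ) {l : ℝ} (hl : 0 < l) :
    bmoQ (cubeSet a l) (fun x : Euc d => Real.log (x i0 - a i0)) ≤ ENNReal.ofReal 2 := by
  refine iSup₂_le fun x hx => iSup₂_le fun Q hQ => ENNReal.ofReal_le_ofReal ?_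
  obtain ⟨⟨b, h, hh, rfl⟩, hxQ, hsub⟩ := hQ
  have hb : a i0 ≤ b i0 := by
    have : (WithLp.toLp 2 b : Euc d) ∈ cubeSet b h := fun i => ⟨le_rfl, by simp [hh.le]⟩
    exact (hsub this i0).1
  set f : Euc d → ℝ := fun x => Real.log (x i0 - a i0) with hf
  set M := Real.log (b i0 - a i0 + h) with hM
  have hfi : IntegrableOn f (cubeSet b h) := s9_f_int i0 (a i0) b hh.le
  set μ := volume.restrict (cubeSet b h) with hμ
  have hvol : μ.real univ = h ^ d := by
    rw [hμ, measureReal_def, Measure.restrict_apply_univ, s9_volume_cubeSet b hh.le,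
      ENNReal.toReal_ofReal (by positivity)]
  have hfin : IsFiniteMeasure μ := ⟨by
    rw [hμ, Measure.restrict_apply_univ, s9_volume_cubeSet b hh.le]; simp⟩
  have hosc : ∫ x, |f x - M| ∂μ ≤ h ^ d := s9_f_osc i0 (a i0) b hh hb
  have hpos : 0 < h ^ d := by positivity
  have hav : |M - ⨍ z, f z ∂μ| ≤ 1 := by
    rw [average_eq, hvol, smul_eq_mul]
    have e : M - (h ^ d)⁻¹ * ∫ x, f x ∂μ = -((h ^ d)⁻¹ * ∫ x, (f x - M) ∂μ) := by
      rw [integral_sub hfi (integrable_const _), integral_const, hvol, smul_eq_mul]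
      field_simp; ring
    rw [e, abs_neg, abs_mul, abs_of_pos (by positivity : 0 < (h ^ d)⁻¹)]
    calc _ ≤ (h ^ d)⁻¹ * h ^ d := by
          gcongr
          exact (abs_integral_le_integral_abs).trans hosc
      _ = 1 := by field_simp
  change ⨍ y, |f y - ⨍ z, f z ∂μ| ∂μ ≤ 2
  rw [average_eq μ (fun y => |f y - ⨍ z, f z ∂μ|), hvol, smul_eq_mul]
  have h5 : ∫ y, |f y - ⨍ z, f z ∂μ| ∂μ ≤ ∫ y, (|f y - M| + 1) ∂μ := by
    refine integral_mono (hfi.sub (integrable_const _)).abs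
      ((hfi.sub (integrable_const _)).abs.add (integrable_const _)) fun y => ?_
    calc |f y - ⨍ z, f z ∂μ| = |(f y - M) + (M - ⨍ z, f z ∂μ)| := by ring_nf
      _ ≤ |f y - M| + |M - ⨍ z, f z ∂μ| := abs_add_le _ _
      _ ≤ _ := by simpa using hav
  have hai : Integrable (fun y => |f y - M|) μ := (hfi.sub (integrable_const _)).abs
  rw [integral_add hai (integrable_const _), integral_const, hvol,
    smul_eq_mul] at h5
  calc _ ≤ (h ^ d)⁻¹ * (h ^ d + h ^ d * 1) := by gcongr; linarith
    _ = 2 := by field_simp; norm_num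

lemma s9_slab {d : ℕ} (i0 : Fin d) (a : Fin d → ℝ) {l : ℝ} (hl : 0 < l) {S : Set ℝ}
    (hS : MeasurableSet S) :
    volume {x ∈ cubeSet a l | x i0 ∈ S} =
      ENNReal.ofReal (l ^ (d-1)) * volume (S ∩ Icc (a i0) (a i0 + l)) := by
  have hm : Measurable fun x : Euc d => x i0 := by fun_prop
  have h1 := congrArg (fun ν => ν S) (s9_map i0 a hl.le)
  simp only [Measure.smul_apply, smul_eq_mul] at h1
  rw [Measure.map_apply hm hS, Measure.restrict_apply (hm hS), Measure.restrict_apply hS] at h1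
  rw [← h1]; congr 1; ext x; simp [and_comm]

lemma s9_f_lower {d : ℕ} (i0 : Fin d) (a : Fin d → ℝ) {l : ℝ} (hl : 0 < l) {c ξ : ℝ}
    (hξ : c - Real.log l ≤ ξ) :
    ENNReal.ofReal (l ^ (d-1) * Real.exp (c - ξ)) ≤
      volume {x ∈ cubeSet a l | ξ < |Real.log (x i0 - a i0) - c|} := by
  have h1 : Real.exp (c - ξ) ≤ l := by
    rw [← Real.le_log_iff_exp_le hl]; linarith
  have h2 := s9_slab i0 a hl (S := Ioo (a i0) (a i0 + Real.exp (c - ξ))) measurableSet_Ioo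
  have h3 : Ioo (a i0) (a i0 + Real.exp (c - ξ)) ∩ Icc (a i0) (a i0 + l) =
      Ioo (a i0) (a i0 + Real.exp (c - ξ)) :=
    inter_eq_left.2 fun y hy => ⟨hy.1.le, by linarith [hy.2]⟩
  rw [h3, Real.volume_Ioo, add_sub_cancel_left, ← ENNReal.ofReal_mul (by positivity)] at h2
  rw [← h2]
  refine measure_mono ?_
  rintro x ⟨hx, hx1, hx2⟩
  refine ⟨hx, ?_⟩
  have : Real.log (x i0 - a i0) < c - ξ := by
    rw [Real.log_lt_iff_lt_exp (by linarith)]; linarith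
  rw [lt_abs]; right; linarith

lemma s9_f_upper {d : ℕ} (i0 : Fin d) (a : Fin d → ℝ) {l : ℝ} (hl : 0 < l) {ξ : ℝ}
    (hξ : |Real.log l| ≤ ξ) :
    volume {x ∈ cubeSet a l | ξ < |Real.log (x i0 - a i0)|} ≤
      ENNReal.ofReal (l ^ (d-1) * Real.exp (- ξ)) := by
  have h2 := s9_slab i0 a hl (S := Ioo (a i0) (a i0 + Real.exp (- ξ))) measurableSet_Ioo
  have h3 : volume (Ioo (a i0) (a i0 + Real.exp (- ξ)) ∩ Icc (a i0) (a i0 + l)) ≤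
      ENNReal.ofReal (Real.exp (-ξ)) := by
    refine (measure_mono inter_subset_left).trans ?_
    rw [Real.volume_Ioo, add_sub_cancel_left]
  rw [ENNReal.ofReal_mul (by positivity)]
  refine le_trans ?_ (mul_le_mul_right h3 _)
  rw [← h2]
  refine measure_mono ?_
  rintro x ⟨hx, hx1⟩
  refine ⟨hx, ?_⟩
  have hξ0 : 0 ≤ ξ := (abs_nonneg _).trans hξ
  have hx0 := hx i0
  rcases hx0.1.eq_or_lt with h | h
  · rw [← h, sub_self, Real.log_zero, abs_zero] at hx1; linarith
  · have h6 : Real.log (x i0 - a i0) ≤ Real.log l := Real.log_le_log (by linarith) (by linarith)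
    have h7 := le_abs_self (Real.log l)
    have h8 : Real.log (x i0 - a i0) < -ξ := by
      rcases lt_abs.1 hx1 with h | h <;> linarith
    rw [Real.log_lt_iff_lt_exp (by linarith)] at h8
    exact ⟨h, by linarith⟩

lemma s9_i_iii {d : ℕ} (hd : 0 < d) {a : Fin d → ℝ} {l : ℝ} (hl : 0 < l) {lam : ℝ}
    (hlam : 0 < lam)
    (H : ∀ f : Euc d → ℝ, Measurable f → IntegrableOn f (cubeSet a l) volume →
        bmoQ (cubeSet a l) f ≠ ∞ →
        ∃ c₁ c₂ : ℝ, 0 < c₁ ∧ 0 < c₂ ∧ ∀ ξ : ℝ, 0 < ξ →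
          volume {x ∈ cubeSet a l | ξ < |f x - ⨍ z in cubeSet a l, f z|} ≤
            ENNReal.ofReal (c₁ *
              Real.exp (-c₂ * (ξ / (bmoQ (cubeSet a l) f).toReal) ^ ((1 : ℝ) / lam)))) :
    1 ≤ lam := by
  by_contra hlt
  push Not at hlt
  set i0 : Fin d := ⟨0, hd⟩
  set f : Euc d → ℝ := fun x => Real.log (x i0 - a i0) with hfd
  have hf : Measurable f := by
    have hm : Measurable fun x : Euc d => x i0 - a i0 := by fun_prop
    exact Real.measurable_log.comp hm
  have hfi : IntegrableOn f (cubeSet a l) := s9_f_int i0 (a i0) a hl.le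
  have hbm := s9_f_bmo i0 a hl
  have hbt : bmoQ (cubeSet a l) f ≠ ∞ := ne_top_of_le_ne_top (by simp) hbm
  obtain ⟨c₁, c₂, hc₁, hc₂, h⟩ := H f hf hfi hbt
  set c := ⨍ z in cubeSet a l, f z with hc
  set B := (bmoQ (cubeSet a l) f).toReal with hB
  have hlow : ∀ ξ, c - Real.log l ≤ ξ → ENNReal.ofReal (l ^ (d-1) * Real.exp (c - ξ)) ≤
      volume {x ∈ cubeSet a l | ξ < |f x - c|} := fun ξ hξ => s9_f_lower i0 a hl hξ
  have hB0 : 0 ≤ B := ENNReal.toReal_nonneg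
  have hBp : 0 < B := by
    rcases hB0.eq_or_lt with h0 | h0
    · exfalso
      set ξ := max 0 (c - Real.log l)
      have h1 : ∀ j : ℕ, l ^ (d-1) * Real.exp (c - ξ) ≤ l ^ d * (1/2) ^ j := by
        intro j
        have := (hlow ξ (le_max_right _ _)).trans
          (s9_jn_dyadic hd hl hf hfi hB0 (by rw [hB, ENNReal.ofReal_toReal hbt]) j (ξ := ξ)
          (by rw [← h0, mul_zero]; exact le_max_left _ _))
        rwa [ENNReal.ofReal_le_ofReal_iff (by positivity)] at this
      have h2 : Tendsto (fun j : ℕ => l ^ d * (1/2:ℝ) ^ j) atTop (nhds (l ^ d * 0)) :=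
        (_root_.tendsto_pow_atTop_nhds_zero_of_lt_one (by norm_num) (by norm_num)).const_mul _
      have h3 := ge_of_tendsto' h2 h1
      have : 0 < l ^ (d-1) * Real.exp (c - ξ) := by positivity
      linarith
    · exact h0
  set q := 1/lam with hq
  have hq1 : 1 < q := by rw [hq, lt_div_iff₀ hlam]; linarith
  set k := c₂ * (1/B) ^ q with hk
  have hk0 : 0 < k := by positivity
  set D := Real.log c₁ - Real.log (l ^ (d-1)) - c with hD
  have ev : ∀ᶠ ξ : ℝ in atTop, 2 / k ≤ ξ ^ (q - 1) ∧ D + 1 ≤ ξ ∧ 1 ≤ ξ ∧ c - Real.log l ≤ ξ :=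
    ((tendsto_rpow_atTop (by linarith)).eventually_ge_atTop _).and
      ((eventually_ge_atTop _).and ((eventually_ge_atTop _).and (eventually_ge_atTop _)))
  obtain ⟨ξ, h1, h2, h3, h4⟩ := ev.exists
  have hξ : 0 < ξ := by linarith
  have h5 := (hlow ξ h4).trans (h ξ hξ)
  rw [ENNReal.ofReal_le_ofReal_iff (by positivity)] at h5
  have h6 := Real.log_le_log (by positivity) h5
  rw [Real.log_mul (by positivity) (Real.exp_pos _).ne', Real.log_exp,
    Real.log_mul (by positivity) (Real.exp_pos _).ne', Real.log_exp] at h6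
  have e1 : c₂ * (ξ / B) ^ q = k * ξ ^ (q-1) * ξ := by
    rw [hk, div_eq_mul_one_div ξ, Real.mul_rpow hξ.le (by positivity)]
    have : ξ ^ q = ξ ^ (q-1) * ξ := by
      conv_rhs => rw [← Real.rpow_one ξ, ← Real.rpow_mul hξ.le, ← Real.rpow_add hξ]
      congr 1; ring
    rw [this]; ring
  have h7 : 2 * ξ ≤ k * ξ ^ (q-1) * ξ := by
    refine mul_le_mul_of_nonneg_right ?_ hξ.le
    rwa [div_le_iff₀' hk0] at h1
  have e2 : -c₂ * (ξ / B) ^ q = -(c₂ * (ξ / B) ^ q) := by ring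
  rw [e2, e1] at h6
  linarith

lemma s9_f_lorentz {d : ℕ} (i0 : Fin d) (a : Fin d → ℝ) {l : ℝ} (hl : 0 < l) :
    lorentz (volume.restrict (cubeSet a l)) (fun x : Euc d => Real.log (x i0 - a i0)) 2 ∞
      (Ioo 0 1) ≠ ∞ := by
  set D := |Real.log l| + |Real.log (l ^ (d-1))| with hD
  refine ne_top_of_le_ne_top (b := ENNReal.ofReal (D + 2)) (by simp) ?_
  simp only [lorentz, qnorm, if_true]
  refine iSup₂_le fun t ht => ?_
  have hlt : Real.log t < 0 := Real.log_neg ht.1 ht.2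
  have hr : rearrR (volume.restrict (cubeSet a l)) (fun x : Euc d => Real.log (x i0 - a i0)) t ≤
      ENNReal.ofReal (D - Real.log t) := by
    refine s9_rearr_le ?_
    rw [Measure.restrict_apply' (s9_measurableSet_cubeSet a l)]
    have hge : |Real.log l| ≤ D - Real.log t := by
      have := abs_nonneg (Real.log (l ^ (d-1)))
      linarith
    have h0 : 0 ≤ D - Real.log t := (abs_nonneg _).trans hge
    refine (measure_mono ?_).trans ((s9_f_upper i0 a hl hge).trans ?_)
    · rintro x ⟨hx1, hx2⟩
      exact ⟨hx2, (ENNReal.ofReal_lt_ofReal_iff_of_nonneg h0).1 hx1⟩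
    · refine ENNReal.ofReal_le_ofReal ?_
      have e : l ^ (d-1) = Real.exp (Real.log (l ^ (d-1))) := (Real.exp_log (by positivity)).symm
      calc l ^ (d-1) * Real.exp (-(D - Real.log t))
          = Real.exp (Real.log (l ^ (d-1))) * Real.exp (-(D - Real.log t)) := by rw [← e]
        _ = Real.exp (Real.log (l ^ (d-1)) - (D - Real.log t)) := by rw [← Real.exp_add]; ring_nf
        _ ≤ Real.exp (Real.log t) := by
            rw [Real.exp_le_exp]
            have := le_abs_self (Real.log (l ^ (d-1)))
            have := abs_nonneg (Real.log l)
            linarith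
        _ = t := Real.exp_log ht.1
  refine (mul_le_mul_right hr _).trans ?_
  have ht0 := ht.1
  rw [← ENNReal.ofReal_mul (by positivity)]
  refine ENNReal.ofReal_le_ofReal ?_
  have hs : 0 < t ^ ((1:ℝ)/2) := by positivity
  have hs1 : t ^ ((1:ℝ)/2) ≤ 1 := Real.rpow_le_one ht.1.le ht.2.le (by norm_num)
  have h1 : Real.log (t ^ ((1:ℝ)/2))⁻¹ ≤ (t ^ ((1:ℝ)/2))⁻¹ := Real.log_le_self (by positivity)
  rw [Real.log_inv, Real.log_rpow ht.1] at h1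
  have h2 : t ^ ((1:ℝ)/2) * (-(1/2 * Real.log t)) ≤ 1 := by
    calc _ ≤ t ^ ((1:ℝ)/2) * (t ^ ((1:ℝ)/2))⁻¹ := by gcongr
      _ = 1 := mul_inv_cancel₀ hs.ne'
  have hD0 : 0 ≤ D := by positivity
  nlinarith

lemma s9_ii_iii {d : ℕ} (hd : 0 < d) {a : Fin d → ℝ} {l : ℝ} (hl : 0 < l) {lam : ℝ}
    (hlam : 0 < lam)
    (H : ∃ C : ℝ, 0 < C ∧ ∀ f : Euc d → ℝ, Measurable f → IntegrableOn f (cubeSet a l) volume →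
          lorentz (volume.restrict (cubeSet a l)) f 2 ∞ (Set.Ioo 0 1) ≠ ∞ →
          ∀ t ∈ Set.Ioo (0 : ℝ) 1,
            qint ∞ (Set.Ioo 0 (t * (1 - Real.log t) ^ (-(lam * 2))))
                (fun u => ENNReal.ofReal (u ^ ((1:ℝ) / 2)) *
                  rearrR (volume.restrict (cubeSet a l)) (fun x => f x - ⨍ z in (cubeSet a l), f z) u) ≤
              ENNReal.ofReal C *
                qint ∞ (Set.Ioo 0 t)
                  (fun u => ENNReal.ofReal (u ^ ((1:ℝ) / 2)) *
                    rearr (volume.restrict (cubeSet a l)) (sharpLocal volume (cubeSet a l) f) u)) :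
    1 ≤ lam := by
  by_contra hlt
  push Not at hlt
  set i0 : Fin d := ⟨0, hd⟩
  set f : Euc d → ℝ := fun x => Real.log (x i0 - a i0) with hfd
  have hf : Measurable f := by
    have hm : Measurable fun x : Euc d => x i0 - a i0 := by fun_prop
    exact Real.measurable_log.comp hm
  have hfi : IntegrableOn f (cubeSet a l) := s9_f_int i0 (a i0) a hl.le
  have hbm := s9_f_bmo i0 a hl
  obtain ⟨C, hC, h⟩ := H
  replace h := h f hf hfi (s9_f_lorentz i0 a hl)
  set c := ⨍ z in cubeSet a l, f z with hc
  set D := Real.log (l ^ (d-1)) + c with hD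
  have ev : ∀ᶠ L : ℝ in atTop, 8 * C ≤ L ^ (1 - lam) ∧ 2 * (1 - D) + 1 ≤ L ∧ 2 ≤ L ∧
      c - Real.log l - D + 1 ≤ L ∧ 1 - D ≤ L :=
    ((tendsto_rpow_atTop (by linarith)).eventually_ge_atTop _).and
      ((eventually_ge_atTop _).and ((eventually_ge_atTop _).and
      ((eventually_ge_atTop _).and (eventually_ge_atTop _))))
  obtain ⟨L, h1, h2, h3, h4, h5⟩ := ev.exists
  set t := Real.exp (1 - L) with ht
  have ht0 : 0 < t := Real.exp_pos _
  have ht1 : t < 1 := by rw [ht, Real.exp_lt_one_iff]; linarith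
  have hL : 1 - Real.log t = L := by rw [ht, Real.log_exp]; ring
  have hL0 : 0 < L := by linarith
  have h6 := h t ⟨ht0, ht1⟩
  simp only [qint, if_true] at h6
  rw [hL] at h6
  set s := t * L ^ (-(lam * 2)) with hs
  have hs0 : 0 < s := by positivity
  have hst : s ≤ t := by
    refine mul_le_of_le_one_right ht0.le ?_
    exact Real.rpow_le_one_of_one_le_of_nonpos (by linarith) (by nlinarith)
  -- lower bound for the rearrangement
  have hlow : ENNReal.ofReal (D - 1 + L) ≤
      rearrR (volume.restrict (cubeSet a l)) (fun x => f x - c) (s/2) := by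
    refine s9_le_rearr fun b hb => ?_
    rw [Measure.restrict_apply' (s9_measurableSet_cubeSet a l)]
    have h7 := s9_f_lower i0 a hl (c := c) (ξ := D - 1 + L) (by linarith)
    have e : l ^ (d-1) * Real.exp (c - (D - 1 + L)) = t := by
      have e : l ^ (d-1) = Real.exp (Real.log (l ^ (d-1))) := (Real.exp_log (by positivity)).symm
      rw [e, ← Real.exp_add, ht]; congr 1; rw [hD]; ring
    rw [e] at h7
    refine lt_of_lt_of_le ?_ (h7.trans (measure_mono ?_))
    · exact (ENNReal.ofReal_lt_ofReal_iff ht0).2 (by linarith)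
    · rintro x ⟨hx1, hx2⟩
      exact ⟨lt_of_lt_of_le hb (ENNReal.ofReal_le_ofReal hx2.le), hx1⟩
  have hl1 : ENNReal.ofReal ((s/2) ^ ((1:ℝ)/2)) * ENNReal.ofReal (D - 1 + L) ≤
      ENNReal.ofReal C * (ENNReal.ofReal (t ^ ((1:ℝ)/2)) * ENNReal.ofReal 2) := by
    refine (mul_le_mul_right hlow _).trans ?_
    refine le_trans ?_ (h6.trans (mul_le_mul_right ?_ _))
    · exact le_iSup₂_of_le (f := fun u (_ : u ∈ Ioo 0 s) => ENNReal.ofReal (u ^ ((1:ℝ) / 2)) *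
        rearrR (volume.restrict (cubeSet a l)) (fun x => f x - c) u) (s/2)
        ⟨by positivity, by linarith⟩ le_rfl
    · refine iSup₂_le fun u hu => ?_
      refine mul_le_mul' (ENNReal.ofReal_le_ofReal ?_) (s9_rearr_le_bmo hbm u)
      exact Real.rpow_le_rpow hu.1.le hu.2.le (by norm_num)
  rw [← ENNReal.ofReal_mul (by positivity), ← ENNReal.ofReal_mul (by positivity),
    ← ENNReal.ofReal_mul hC.le, ENNReal.ofReal_le_ofReal_iff (by positivity)] at hl1
  have e1 : s ^ ((1:ℝ)/2) = t ^ ((1:ℝ)/2) * L ^ (-lam) := by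
    rw [hs, Real.mul_rpow ht0.le (by positivity), ← Real.rpow_mul hL0.le]
    congr 2; ring
  have e2 : s ^ ((1:ℝ)/2) ≤ 2 * (s/2) ^ ((1:ℝ)/2) := by
    have h8 : (s/2) ^ ((1:ℝ)/2) = s ^ ((1:ℝ)/2) / 2 ^ ((1:ℝ)/2) := Real.div_rpow hs0.le (by norm_num) _
    have h9 : (2:ℝ) ^ ((1:ℝ)/2) ≤ 2 := by
      calc (2:ℝ) ^ ((1:ℝ)/2) ≤ 2 ^ (1:ℝ) := Real.rpow_le_rpow_of_exponent_le (by norm_num) (by norm_num)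
        _ = 2 := Real.rpow_one 2
    rw [h8, ← mul_div_assoc, le_div_iff₀ (by positivity), mul_comm]
    gcongr
  have hDL : 0 ≤ D - 1 + L := by linarith
  have h10 : t ^ ((1:ℝ)/2) * (L ^ (-lam) * (D - 1 + L)) ≤ t ^ ((1:ℝ)/2) * (4 * C) := by
    have := mul_le_mul_of_nonneg_right e2 hDL
    rw [e1] at this
    nlinarith
  have h11 := le_of_mul_le_mul_left h10 (by positivity)
  have h12 : D - 1 + L ≤ 4 * C * L ^ lam := by
    rw [Real.rpow_neg hL0.le, inv_mul_le_iff₀ (by positivity)] at h11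
    linarith
  have e3 : L ^ (1 - lam) * L ^ lam = L := by
    rw [← Real.rpow_add hL0]; simp
  have h13 : 8 * C * L ^ lam ≤ L := by
    calc _ ≤ L ^ (1 - lam) * L ^ lam := by gcongr
      _ = L := e3
  linarith

/-- Equivalence of the John–Nirenberg inequality with exponent `1/λ`, the
logarithmic oscillation inequality, and the condition `λ ≥ 1`
(the characterization theorem following Theorem 1.9). -/
theorem statement9 (d : ℕ) (hd : 0 < d) (Q0 : Set (Euc d)) (hQ0 : IsCube Q0)
    (lam : ℝ) (hlam : 0 < lam) :
    ((∀ f : Euc d → ℝ, Measurable f → IntegrableOn f Q0 volume → bmoQ Q0 f ≠ ∞ →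
        ∃ c₁ c₂ : ℝ, 0 < c₁ ∧ 0 < c₂ ∧ ∀ ξ : ℝ, 0 < ξ →
          volume {x ∈ Q0 | ξ < |f x - ⨍ z in Q0, f z|} ≤
            ENNReal.ofReal (c₁ *
              Real.exp (-c₂ * (ξ / (bmoQ Q0 f).toReal) ^ ((1 : ℝ) / lam)))) ↔
      (∀ p : ℝ, 1 < p → ∀ r : ℝ≥0∞, 0 < r →
        ∃ C : ℝ, 0 < C ∧ ∀ f : Euc d → ℝ, Measurable f → IntegrableOn f Q0 volume →
          lorentz (volume.restrict Q0) f p r (Set.Ioo 0 1) ≠ ∞ →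
          ∀ t ∈ Set.Ioo (0 : ℝ) 1,
            qint r (Set.Ioo 0 (t * (1 - Real.log t) ^ (-(lam * p))))
                (fun u => ENNReal.ofReal (u ^ (1 / p)) *
                  rearrR (volume.restrict Q0) (fun x => f x - ⨍ z in Q0, f z) u) ≤
              ENNReal.ofReal C *
                qint r (Set.Ioo 0 t)
                  (fun u => ENNReal.ofReal (u ^ (1 / p)) *
                    rearr (volume.restrict Q0) (sharpLocal volume Q0 f) u))) ∧
    ((∀ p : ℝ, 1 < p → ∀ r : ℝ≥0∞, 0 < r →
        ∃ C : ℝ, 0 < C ∧ ∀ f : Euc d → ℝ, Measurable f → IntegrableOn f Q0 volume →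
          lorentz (volume.restrict Q0) f p r (Set.Ioo 0 1) ≠ ∞ →
          ∀ t ∈ Set.Ioo (0 : ℝ) 1,
            qint r (Set.Ioo 0 (t * (1 - Real.log t) ^ (-(lam * p))))
                (fun u => ENNReal.ofReal (u ^ (1 / p)) *
                  rearrR (volume.restrict Q0) (fun x => f x - ⨍ z in Q0, f z) u) ≤
              ENNReal.ofReal C *
                qint r (Set.Ioo 0 t)
                  (fun u => ENNReal.ofReal (u ^ (1 / p)) *
                    rearr (volume.restrict Q0) (sharpLocal volume Q0 f) u)) ↔
      1 ≤ lam) := by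
  obtain ⟨a, l, hl, rfl⟩ := hQ0
  refine ⟨Iff.trans (b := 1 ≤ lam)
    ⟨fun H => s9_i_iii hd (a := a) hl hlam H, fun h f hf hfi hb => s9_iii_i hd hl h hf hfi hb⟩
    ⟨fun h p hp r hr => s9_iii_ii hd (a := a) hl h hp hr,
      fun H => s9_ii_iii hd (a := a) hl hlam (H 2 (by norm_num) ∞ (by simp))⟩,
    ⟨fun H => s9_ii_iii hd (a := a) hl hlam (H 2 (by norm_num) ∞ (by simp)),
      fun h p hp r hr => s9_iii_ii hd (a := a) hl h hp hr⟩⟩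

end
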